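/- arXiv:1708.02692 — 2 statements merged into one kernel-verified Lean document; each statement's English description precedes it below -/
import Mathlib

section
/- For n ≥ 4, the R_2-vertex-connectivity of the star graph S_n satisfies κ^2(S_n) = 6(n−3). -/
/-- The transposition generating graph `G(𝒯)` of a set `T` of transpositions of `Sym(n)`:
vertices `{1,…,n}` (modeled as `Fin n`), with an edge `i j` iff the transposition
`(i j)` belongs to `T`. -/
def transGraph {n : ℕ} (T : Set (Equiv.Perm (Fin n))) : SimpleGraph (Fin n) :=
  SimpleGraph.fromRel (fun i j => Equiv.swap i j ∈ T)

/-- The Cayley graph `Cay(Sym(n), T)`: vertices are permutations, and `g, h` are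
adjacent iff `h = g * t` for some `t ∈ T`. -/
def cayley {n : ℕ} (T : Set (Equiv.Perm (Fin n))) : SimpleGraph (Equiv.Perm (Fin n)) :=
  SimpleGraph.fromRel (fun g h => ∃ t ∈ T, h = g * t)

/-- `G` is a `k`-tree: there is a construction ordering of the vertices in which the
first `k+1` vertices are mutually adjacent, and each later vertex is joined to exactly
`k` mutually adjacent earlier vertices. -/
def IsKTree (k : ℕ) {V : Type*} [Fintype V] (G : SimpleGraph V) : Prop :=
  k + 1 ≤ Fintype.card V ∧
  ∃ e : Fin (Fintype.card V) ≃ V,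
    (∀ i j : Fin (Fintype.card V), j < i → (i : ℕ) ≤ k → G.Adj (e i) (e j)) ∧
    ∀ i : Fin (Fintype.card V), k + 1 ≤ (i : ℕ) →
      {j : Fin (Fintype.card V) | j < i ∧ G.Adj (e i) (e j)}.ncard = k ∧
      {j : Fin (Fintype.card V) | j < i ∧ G.Adj (e i) (e j)}.Pairwise
        (fun j₁ j₂ => G.Adj (e j₁) (e j₂))

/-- `F` is an `R_k`-vertex-cut of `G`: `G - F` is disconnected and every vertex of
`G - F` has at least `k` neighbors in `G - F`. -/
def IsRkCut {V : Type*} (G : SimpleGraph V) (k : ℕ) (F : Set V) : Prop :=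
  ¬ (G.induce (Fᶜ : Set V)).Connected ∧
  ∀ v : V, v ∉ F → k ≤ {u : V | u ∉ F ∧ G.Adj v u}.ncard

/-- The `R_k`-vertex-connectivity `κ^k(G)`: the minimum cardinality of an
`R_k`-vertex-cut of `G`. -/
noncomputable def rkConn {V : Type*} (G : SimpleGraph V) (k : ℕ) : ℕ :=
  sInf {m : ℕ | ∃ F : Set V, IsRkCut G k F ∧ F.ncard = m}

set_option linter.all false
set_option linter.unusedSectionVars false
set_option linter.unusedVariables false
namespace StarAux
open Equiv Finset

variable {α : Type*} [Fintype α] [DecidableEq α]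

lemma fib {β γ : Type*} [DecidableEq β] [DecidableEq γ] (s : Finset β) (f : β → γ) (I : Finset γ)
    (c : ℕ) (h : ∀ i ∈ I, c ≤ (s.filter (fun x => f x = i)).card) : I.card * c ≤ s.card := by
  have h1 : (I.biUnion (fun i => s.filter (fun x => f x = i))).card
      = ∑ i ∈ I, (s.filter (fun x => f x = i)).card := by
    apply card_biUnion
    intro i _ j _ hij
    rw [Function.onFun, Finset.disjoint_filter]
    exact fun x _ a b => hij (a.symm.trans b)
  have h2 : (I.biUnion (fun i => s.filter (fun x => f x = i))).card ≤ s.card :=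
    card_le_card (biUnion_subset.2 fun i _ => filter_subset _ _)
  have h3 := Finset.card_nsmul_le_sum I (fun i => (s.filter (fun x => f x = i)).card) c h
  rw [smul_eq_mul] at h3
  omega

lemma swap_one (z : α) : swap z z = (1 : Perm α) := swap_self z

/-- closed neighbourhood -/
def cn (z : α) (P : Finset α) (v : Perm α) : Finset (Perm α) :=
  (insert z P).image (fun k => v * swap z k)

def NN (z : α) (P : Finset α) (K : Finset (Perm α)) : Finset (Perm α) := K.biUnion (cn z P)

def X (z : α) (P : Finset α) (g0 : Perm α) : Finset (Perm α) :=
  univ.filter (fun g => ∀ x, x ∉ insert z P → g x = g0 x)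

def dg (z : α) (P : Finset α) (K : Finset (Perm α)) (g : Perm α) : ℕ :=
  (P.filter (fun k => g * swap z k ∈ K)).card

structure Sep (z : α) (P : Finset α) (g0 : Perm α) (A B F : Finset (Perm α)) : Prop where
  hz : z ∉ P
  hA : A ⊆ X z P g0
  hB : B ⊆ X z P g0
  cov : ∀ g ∈ X z P g0, g ∈ A ∨ g ∈ B ∨ g ∈ F
  ne : ∀ a ∈ A, ∀ b ∈ B, ∀ k ∈ insert z P, a * swap z k ≠ b

lemma mem_cn {z : α} {P : Finset α} {v h : Perm α} :
    h ∈ cn z P v ↔ ∃ k ∈ insert z P, v * swap z k = h := by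
  simp only [cn, Finset.mem_image]

lemma self_mem_cn (z : α) (P : Finset α) (v : Perm α) : v ∈ cn z P v :=
  mem_cn.2 ⟨z, by simp, by rw [swap_one, mul_one]⟩

lemma swap_inj (z : α) {k l : α} (h : swap z k = swap z l) : k = l := by
  have := congrArg (fun f : Perm α => f z) h
  simpa using this

lemma card_cn (z : α) (P : Finset α) (hz : z ∉ P) (v : Perm α) : (cn z P v).card = P.card + 1 := by
  rw [cn, Finset.card_image_of_injective, Finset.card_insert_of_notMem hz]
  intro k l h
  exact swap_inj z (mul_left_cancel h)

lemma tri (z a b k : α) (hk : k ≠ z) (h : swap z a = swap z k * swap z b) : a = z ∨ b = z := by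
  by_contra hc
  push Not at hc
  have := congrArg Perm.sign h
  rw [Perm.sign_mul, Perm.sign_swap hc.1.symm, Perm.sign_swap hc.2.symm, Perm.sign_swap hk.symm] at this
  revert this; decide

lemma quad (z a b k l : α) (hk : k ≠ z) (hl : l ≠ z) (hkl : k ≠ l) (ha : a ≠ z) (hb : b ≠ z)
    (h : swap z k * swap z a = swap z l * swap z b) : a = k ∧ b = l := by
  have h1 := congrArg (fun f : Perm α => f z) h
  have h2 := congrArg (fun f : Perm α => f a) h
  have h3 := congrArg (fun f : Perm α => f b) h
  simp only [Perm.mul_apply, swap_apply_def] at h1 h2 h3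
  grind

lemma cn_inter1 (z : α) (P : Finset α) (v : Perm α) (k : α) (hk : k ≠ z) :
    cn z P v ∩ cn z P (v * swap z k) ⊆ {v, v * swap z k} := by
  intro h hh
  rw [mem_inter, mem_cn, mem_cn] at hh
  obtain ⟨⟨a, -, rfl⟩, ⟨b, -, hb⟩⟩ := hh
  rw [mul_assoc] at hb
  have := mul_left_cancel hb
  rcases tri z a b k hk this.symm with rfl | rfl
  · simp [swap_one, -swap_self]
  · rw [swap_one, mul_one] at this; simp [← this]

lemma cn_inter2 (z : α) (P : Finset α) (v : Perm α) (k l : α) (hk : k ≠ z) (hl : l ≠ z)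
    (hkl : k ≠ l) :
    cn z P (v * swap z k) ∩ cn z P (v * swap z l) ⊆ {v} := by
  intro h hh
  rw [mem_inter, mem_cn, mem_cn] at hh
  obtain ⟨⟨a, -, rfl⟩, ⟨b, -, hb⟩⟩ := hh
  rw [mul_assoc, mul_assoc] at hb
  have hb := mul_left_cancel hb
  by_cases ha : a = z
  · subst ha
    rw [swap_one, mul_one] at hb
    rcases tri a k b l hl hb.symm with h | h
    · exact absurd h hk
    · subst h; exact absurd (swap_inj b (by rwa [swap_one, mul_one] at hb)).symm hkl
  by_cases hb' : b = z
  · subst hb'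
    rw [swap_one, mul_one] at hb
    rcases tri b l a k hk hb with h | h
    · exact absurd h hl
    · exact absurd h ha
  obtain ⟨rfl, rfl⟩ := quad z a b k l hk hl hkl ha hb' hb.symm
  simp [mul_assoc]

lemma card_edge (z : α) (P : Finset α) (hz : z ∉ P) (v : Perm α) (k : α) (hk : k ≠ z) :
    2 * P.card ≤ (cn z P v ∪ cn z P (v * swap z k)).card := by
  have h1 := card_union_add_card_inter (cn z P v) (cn z P (v * swap z k))
  have h2 := (card_le_card (cn_inter1 z P v k hk)).trans card_le_two
  rw [card_cn z P hz, card_cn z P hz] at h1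
  omega

lemma card_p3 (z : α) (P : Finset α) (hz : z ∉ P) (v : Perm α) (k l : α) (hk : k ≠ z)
    (hl : l ≠ z) (hkl : k ≠ l) :
    3 * P.card ≤ (cn z P v ∪ cn z P (v * swap z k) ∪ cn z P (v * swap z l)).card + 1 := by
  have h1 := card_union_add_card_inter (cn z P v) (cn z P (v * swap z k))
  have h2 := (card_le_card (cn_inter1 z P v k hk)).trans card_le_two
  have h3 := card_union_add_card_inter (cn z P v ∪ cn z P (v * swap z k)) (cn z P (v * swap z l))
  have h4 : (cn z P v ∪ cn z P (v * swap z k)) ∩ (cn z P (v * swap z l)) ⊆ {v, v * swap z l} := by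
    rw [union_inter_distrib_right]
    apply union_subset (cn_inter1 z P v l hl)
    exact (cn_inter2 z P v k l hk hl hkl).trans (by simp)
  have h5 := (card_le_card h4).trans card_le_two
  rw [card_cn z P hz] at h3
  rw [card_cn z P hz, card_cn z P hz] at h1
  omega

/-- two distinct neighbours -/
lemma two_nb {z : α} {P : Finset α} {K : Finset (Perm α)} {g : Perm α} (h : 2 ≤ dg z P K g) :
    ∃ k ∈ P, ∃ l ∈ P, k ≠ l ∧ g * swap z k ∈ K ∧ g * swap z l ∈ K := by
  obtain ⟨a, ha, b, hb, hab⟩ := Finset.one_lt_card.1 h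
  rw [mem_filter] at ha hb
  exact ⟨a, ha.1, b, hb.1, hab, ha.2, hb.2⟩

lemma one_nb {z : α} {P : Finset α} {K : Finset (Perm α)} {g : Perm α} (h : 1 ≤ dg z P K g) :
    ∃ k ∈ P, g * swap z k ∈ K := by
  obtain ⟨a, ha⟩ := Finset.card_pos.1 h
  rw [mem_filter] at ha
  exact ⟨a, ha.1, ha.2⟩

lemma other_nb {z : α} {P : Finset α} {K : Finset (Perm α)} {g : Perm α} (h : 2 ≤ dg z P K g)
    (j : α) : ∃ k ∈ P, k ≠ j ∧ g * swap z k ∈ K := by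
  obtain ⟨k, hk, l, hl, hkl, h1, h2⟩ := two_nb h
  by_cases hj : k = j
  · exact ⟨l, hl, fun h => hkl (hj.trans h.symm), h2⟩
  · exact ⟨k, hk, hj, h1⟩

lemma three_le (z : α) (P : Finset α) (hz : z ∉ P) (K : Finset (Perm α))
    (hK : ∀ g ∈ K, 2 ≤ dg z P K g) (v : Perm α) (hv : v ∈ K) :
    3 ≤ (K.filter (fun g => Perm.sign g = Perm.sign v)).card := by
  have nz : ∀ k ∈ P, k ≠ z := fun k hk h => hz (h ▸ hk)
  obtain ⟨k, hk, l, hl, hkl, h1, h2⟩ := two_nb (hK v hv)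
  obtain ⟨a, ha, hak, h3⟩ := other_nb (hK _ h1) k
  obtain ⟨b, hb, hbl, h4⟩ := other_nb (hK _ h2) l
  have s : ∀ k ∈ P, ∀ a ∈ P, Perm.sign (v * swap z k * swap z a) = Perm.sign v := by
    intro k hk a ha
    simp [Perm.sign_mul, Perm.sign_swap (nz k hk).symm, Perm.sign_swap (nz a ha).symm]
  have e1 : ∀ k a, a ≠ k → v * swap z k * swap z a ≠ v := by
    intro k a hak h
    rw [mul_assoc, mul_eq_left] at h
    apply hak
    apply swap_inj z
    rw [← mul_right_inj (swap z k), h]; simp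
  have : ({v, v * swap z k * swap z a, v * swap z l * swap z b} : Finset (Perm α)) ⊆
      K.filter (fun g => Perm.sign g = Perm.sign v) := by
    intro x hx
    simp only [mem_insert, mem_singleton] at hx
    rw [mem_filter]
    rcases hx with rfl | rfl | rfl
    · exact ⟨hv, rfl⟩
    · exact ⟨h3, s _ hk _ ha⟩
    · exact ⟨h4, s _ hl _ hb⟩
  refine le_trans (le_of_eq ?_) (card_le_card this)
  symm
  rw [card_eq_three]
  refine ⟨_, _, _, (e1 k a hak).symm, (e1 l b hbl).symm, ?_, rfl⟩
  intro h
  rw [mul_assoc, mul_assoc] at h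
  exact hak (quad z a b k l (nz k hk) (nz l hl) hkl (nz a ha) (nz b hb) (mul_left_cancel h)).1

lemma six_le (z : α) (P : Finset α) (hz : z ∉ P) (K : Finset (Perm α)) (hne : K.Nonempty)
    (hK : ∀ g ∈ K, 2 ≤ dg z P K g) : 6 ≤ K.card := by
  obtain ⟨v, hv⟩ := hne
  obtain ⟨k, hk, l, hl, hkl, h1, h2⟩ := two_nb (hK v hv)
  have a1 := three_le z P hz K hK v hv
  have a2 := three_le z P hz K hK _ h1
  have hs : Perm.sign (v * swap z k) = - Perm.sign v := by
    rw [Perm.sign_mul, Perm.sign_swap (show z ≠ k from fun h => hz (h ▸ hk))]; simp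
  rw [hs] at a2
  have : Disjoint (K.filter (fun g => Perm.sign g = Perm.sign v))
      (K.filter (fun g => Perm.sign g = - Perm.sign v)) := by
    rw [Finset.disjoint_filter]
    intro x _ h h'
    rw [h] at h'
    rcases Int.units_eq_one_or (Perm.sign v) with h | h <;> rw [h] at h' <;> revert h' <;> decide
  have c := card_le_card (union_subset (filter_subset (fun g => Perm.sign g = Perm.sign v) K)
    (filter_subset (fun g => Perm.sign g = - Perm.sign v) K))
  rw [card_union_of_disjoint this] at c
  omega

lemma NN_mono (z : α) (P : Finset α) {K K' : Finset (Perm α)} (h : K ⊆ K') : NN z P K ⊆ NN z P K' :=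
  biUnion_subset_biUnion_of_subset_left _ h

lemma mem_NN {z : α} {P : Finset α} {K : Finset (Perm α)} {h : Perm α} :
    h ∈ NN z P K ↔ ∃ v ∈ K, ∃ k ∈ insert z P, v * swap z k = h := by
  simp only [NN, mem_biUnion, mem_cn]

lemma cn_sub_NN {z : α} {P : Finset α} {K : Finset (Perm α)} {v : Perm α} (hv : v ∈ K) :
    cn z P v ⊆ NN z P K := subset_biUnion_of_mem (cn z P) hv

/-- moving by positions other than `p` keeps the value at `p` -/
lemma keep {z p : α} {P : Finset α} (hzp : z ≠ p) {k : α} (hk : k ∈ insert z (P.erase p)) (v : Perm α) :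
    (v * swap z k) p = v p := by
  rw [Perm.mul_apply, swap_apply_of_ne_of_ne hzp.symm]
  rintro rfl
  simp [hzp.symm] at hk

lemma NN_keep {z p : α} {P : Finset α} (hzp : z ≠ p) {K : Finset (Perm α)} {h : Perm α}
    (hh : h ∈ NN z (P.erase p) K) : ∃ v ∈ K, v p = h p := by
  obtain ⟨v, hv, k, hk, rfl⟩ := mem_NN.1 hh
  exact ⟨v, hv, (keep hzp hk v).symm⟩

/-- degree in slices -/
lemma dg_slice {z p : α} {P : Finset α} (hz : z ∉ P) (hp : p ∈ P) (K : Finset (Perm α))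
    (g : Perm α) :
    dg z P K g ≤ dg z (P.erase p) (K.filter (fun h => h p = g p)) g + 1 := by
  have hzp : z ≠ p := fun h => hz (h ▸ hp)
  unfold dg
  have : P.filter (fun k => g * swap z k ∈ K) ⊆ insert p
      ((P.erase p).filter (fun k => g * swap z k ∈ K.filter (fun h => h p = g p))) := by
    intro k hk
    rw [mem_filter] at hk
    by_cases hkp : k = p
    · simp [hkp]
    · rw [mem_insert, mem_filter, mem_filter]
      exact Or.inr ⟨by simp [hkp, hk.1], hk.2, keep (P := P) hzp (by simp [hkp, hk.1]) g⟩
  exact (card_le_card this).trans (card_insert_le _ _)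

lemma dg_slice' {z p : α} {P : Finset α} (hz : z ∉ P) (hp : p ∈ P) (K : Finset (Perm α))
    (g : Perm α) (h : g * swap z p ∉ K) :
    dg z P K g ≤ dg z (P.erase p) (K.filter (fun h => h p = g p)) g := by
  have hzp : z ≠ p := fun h => hz (h ▸ hp)
  unfold dg
  apply card_le_card
  intro k hk
  rw [mem_filter] at hk
  have hkp : k ≠ p := by rintro rfl; exact h hk.2
  rw [mem_filter, mem_filter]
  exact ⟨by simp [hkp, hk.1], hk.2, keep (P := P) hzp (by simp [hkp, hk.1]) g⟩

lemma dg_mono {z : α} {P : Finset α} {K K' : Finset (Perm α)} (h : K ⊆ K') (g : Perm α) :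
    dg z P K g ≤ dg z P K' g :=
  card_le_card (fun k hk => by rw [mem_filter] at *; exact ⟨hk.1, h hk.2⟩)

/-- In a two-valued situation, a vertex whose zero entry is outside `J`. -/
lemma exists_out {z p : α} {P : Finset α} (hz : z ∉ P) (hp : p ∈ P) (K : Finset (Perm α))
    (hK : ∀ g ∈ K, 2 ≤ dg z P K g) (i j : α) (hJ : ∀ g ∈ K, g p = i ∨ g p = j)
    (g : Perm α) (hg : g ∈ K) (hgi : g p = i) :
    ∃ g ∈ K, g p = i ∧ g z ≠ i ∧ g z ≠ j ∧ 2 ≤ dg z (P.erase p) (K.filter (fun h => h p = i)) g := by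
  have hzp : z ≠ p := fun h => hz (h ▸ hp)
  have key : ∃ g ∈ K, g p = i ∧ g z ≠ j := by
    by_cases hj : g z = j
    · have h1 := dg_slice hz hp K g
      have h2 := hK g hg
      obtain ⟨k, hk, h3⟩ := one_nb (show 1 ≤ dg z (P.erase p) (K.filter (fun h => h p = g p)) g by omega)
      rw [mem_filter] at h3
      refine ⟨_, h3.1, h3.2.trans hgi, ?_⟩
      rw [Perm.mul_apply, swap_apply_left, ← hj]
      intro h
      have := g.injective h
      subst this
      exact hz (mem_of_mem_erase hk)
    · exact ⟨g, hg, hgi, hj⟩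
  obtain ⟨g, hg, hgi, hj⟩ := key
  have hi : g z ≠ i := by rw [← hgi]; exact fun h => hzp (g.injective h)
  refine ⟨g, hg, hgi, hi, hj, ?_⟩
  rw [← hgi]
  refine (hK g hg).trans (dg_slice' hz hp K g ?_)
  intro h
  rcases hJ _ h with h | h <;> simp at h
  · exact hi h
  · exact hj h

lemma L (z : α) (P : Finset α) (hz : z ∉ P) (K : Finset (Perm α)) (hne : K.Nonempty)
    (hK : ∀ g ∈ K, 2 ≤ dg z P K g) : 6 * (P.card - 1) ≤ (NN z P K).card := by
  induction' hN : P.card with N ih generalizing P K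
  · simp
  obtain ⟨p, hp⟩ : P.Nonempty := by rw [← card_pos]; omega
  have hzp : z ≠ p := fun h => hz (h ▸ hp)
  have hzQ : z ∉ P.erase p := fun h => hz (mem_of_mem_erase h)
  have hQ : (P.erase p).card = N := by rw [card_erase_of_mem hp]; omega
  have hsub : NN z (P.erase p) K ⊆ NN z P K := by
    intro h hh
    obtain ⟨v, hv, k, hk, rfl⟩ := mem_NN.1 hh
    exact mem_NN.2 ⟨v, hv, k, insert_subset_insert _ (erase_subset _ _) hk, rfl⟩
  simp only [Nat.add_sub_cancel]
  by_cases h3 : 3 ≤ (K.image (fun g => g p)).card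
  · have : (K.image (fun g => g p)).card * (2 * N) ≤ (NN z (P.erase p) K).card := by
      apply fib _ (fun g => g p)
      intro i hi
      obtain ⟨g, hg, rfl⟩ := mem_image.1 hi
      have h1 := dg_slice hz hp K g
      have h2 := hK g hg
      obtain ⟨k, hk, h3⟩ := one_nb (show 1 ≤ dg z (P.erase p) (K.filter (fun h => h p = g p)) g by omega)
      have := card_edge z (P.erase p) hzQ g k (fun h => hzQ (h ▸ hk))
      rw [hQ] at this
      refine this.trans (card_le_card ?_)
      apply union_subset
      · intro h hh
        refine mem_filter.2 ⟨cn_sub_NN hg hh, ?_⟩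
        obtain ⟨k, hk, rfl⟩ := mem_cn.1 hh
        exact keep hzp hk _
      · intro h hh
        rw [mem_filter] at h3
        refine mem_filter.2 ⟨cn_sub_NN h3.1 hh, ?_⟩
        obtain ⟨k, hk, rfl⟩ := mem_cn.1 hh
        exact (keep hzp hk _).trans h3.2
    have := card_le_card hsub
    nlinarith
  have hout : ∀ J : Finset α, (∀ g ∈ K, g p ∈ J) →
      (NN z (P.erase p) K).card + (K.filter (fun g => g z ∉ J)).card ≤ (NN z P K).card := by
    intro J hJ
    have hd : Disjoint (NN z (P.erase p) K)
        ((K.filter (fun g => g z ∉ J)).image (fun g => g * swap z p)) := by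
      rw [Finset.disjoint_left]
      intro h h1 h2
      obtain ⟨v, hv, e⟩ := NN_keep hzp h1
      obtain ⟨w, hw, rfl⟩ := mem_image.1 h2
      rw [mem_filter] at hw
      apply hw.2
      have := hJ v hv
      rw [e] at this
      simpa using this
    rw [← card_image_of_injective (K.filter (fun g => g z ∉ J)) (mul_left_injective (swap z p)),
      ← card_union_of_disjoint hd]
    apply card_le_card
    apply union_subset hsub
    intro h hh
    obtain ⟨w, hw, rfl⟩ := mem_image.1 hh
    exact mem_NN.2 ⟨w, (mem_filter.1 hw).1, p, by simp [hp], rfl⟩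
  obtain ⟨g0, hg0⟩ := hne
  by_cases h1 : ∀ g ∈ K, g p = g0 p
  · have o := hout {g0 p} (by simpa using h1)
    have : K.filter (fun g => g z ∉ ({g0 p} : Finset α)) = K := by
      rw [filter_true_of_mem]
      intro g hg
      rw [mem_singleton, ← h1 g hg]
      exact fun h => hzp (g.injective h)
    rw [this] at o
    have s := six_le z P hz K ⟨g0, hg0⟩ hK
    have hK' : ∀ g ∈ K, 2 ≤ dg z (P.erase p) K g := by
      intro g hg
      refine (hK g hg).trans ((dg_slice' hz hp K g ?_).trans (dg_mono (filter_subset _ _) g))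
      intro h
      have := h1 _ h
      rw [← h1 g hg] at this
      simp at this
      exact hzp this
    have i := ih (P.erase p) hzQ K ⟨g0, hg0⟩ hK' hQ
    omega
  · push Not at h1
    obtain ⟨g1, hg1, hne⟩ := h1
    have hJ : ∀ g ∈ K, g p = g0 p ∨ g p = g1 p := by
      intro g hg
      by_contra hc
      push Not at hc
      apply h3
      have : ({g0 p, g1 p, g p} : Finset α) ⊆ K.image (fun g => g p) := by
        intro x hx
        simp only [mem_insert, mem_singleton] at hx
        rcases hx with rfl | rfl | rfl
        exacts [mem_image_of_mem _ hg0, mem_image_of_mem _ hg1, mem_image_of_mem _ hg]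
      refine le_trans (le_of_eq ?_) (card_le_card this)
      symm; rw [card_eq_three]
      exact ⟨_, _, _, hne.symm, hc.1.symm, hc.2.symm, rfl⟩
    have o := hout {g0 p, g1 p} (by simpa using hJ)
    obtain ⟨a, ha, hap, hai, haj, hda⟩ := exists_out hz hp K hK (g0 p) (g1 p) hJ g0 hg0 rfl
    obtain ⟨b, hb, hbp, hbi, hbj, hdb⟩ := exists_out hz hp K hK (g1 p) (g0 p)
      (fun g hg => (hJ g hg).symm) g1 hg1 rfl
    have o2 : 2 ≤ (K.filter (fun g => g z ∉ ({g0 p, g1 p} : Finset α))).card := by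
      apply Finset.one_lt_card.2
      refine ⟨a, ?_, b, ?_, ?_⟩
      · simp [ha, hai, haj]
      · simp [hb, hbi, hbj]
      · rintro rfl; exact hne (hbp.symm.trans hap)
    have part : ∀ a i, 2 ≤ dg z (P.erase p) (K.filter (fun h => h p = i)) a → a ∈ K → a p = i →
        3 * N ≤ ((NN z (P.erase p) K).filter (fun h => h p = i)).card + 1 := by
      intro a i hd ha hai
      obtain ⟨k, hk, l, hl, hkl, e1, e2⟩ := two_nb hd
      have := card_p3 z (P.erase p) hzQ a k l (fun h => hzQ (h ▸ hk)) (fun h => hzQ (h ▸ hl)) hkl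
      rw [hQ] at this
      refine this.trans (Nat.add_le_add_right (card_le_card ?_) 1)
      have : ∀ v ∈ K.filter (fun h => h p = i), cn z (P.erase p) v ⊆
          (NN z (P.erase p) K).filter (fun h => h p = i) := by
        intro v hv h hh
        rw [mem_filter] at hv ⊢
        refine ⟨cn_sub_NN hv.1 hh, ?_⟩
        obtain ⟨k, hk, rfl⟩ := mem_cn.1 hh
        rw [keep hzp hk, hv.2]
      exact union_subset (union_subset (this a (by simp [ha, hai])) (this _ e1)) (this _ e2)
    have pa := part a _ hda ha hap
    have pb := part b _ hdb hb hbp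
    have hd : Disjoint ((NN z (P.erase p) K).filter (fun h => h p = g0 p))
        ((NN z (P.erase p) K).filter (fun h => h p = g1 p)) := by
      rw [Finset.disjoint_filter]
      intro x _ h1 h2
      exact hne (h2.symm.trans h1)
    have c := card_le_card (union_subset (filter_subset (fun h => h p = g0 p) (NN z (P.erase p) K))
      (filter_subset (fun h => h p = g1 p) (NN z (P.erase p) K)))
    rw [card_union_of_disjoint hd] at c
    omega


lemma mem_X {z : α} {P : Finset α} {g0 g : Perm α} :
    g ∈ X z P g0 ↔ ∀ x, x ∉ insert z P → g x = g0 x := by simp only [X, mem_filter_univ]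

lemma X_mul {z : α} {P : Finset α} {g0 g : Perm α} (hg : g ∈ X z P g0) {k : α}
    (hk : k ∈ insert z P) : g * swap z k ∈ X z P g0 := by
  rw [mem_X] at *
  intro x hx
  rw [← hg x hx, Perm.mul_apply, swap_apply_of_ne_of_ne]
  · rintro rfl; simp at hx
  · rintro rfl; exact hx hk

lemma X_slice {z p : α} {P : Finset α} (hzp : z ≠ p) (hp : p ∈ P) {g0 g1 g : Perm α}
    (h1 : g1 ∈ X z P g0) : g ∈ X z (P.erase p) g1 ↔ g ∈ X z P g0 ∧ g p = g1 p := by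
  simp only [mem_X] at *
  constructor
  · intro h
    refine ⟨fun x hx => (h x ?_).trans (h1 x hx), h p ?_⟩
    · simp at hx ⊢; tauto
    · simp [hzp.symm]
  · rintro ⟨h, hpp⟩ x hx
    by_cases hxp : x = p
    · rw [hxp, hpp]
    · have : x ∉ insert z P := by simp at hx ⊢; tauto
      rw [h x this, h1 x this]

lemma X_val {z : α} {P : Finset α} {g0 g : Perm α} (hg : g ∈ X z P g0) {x : α}
    (hx : x ∈ insert z P) : g x ∈ (insert z P).image g0 := by
  rw [mem_X] at hg
  by_contra hc
  have hy : g0.symm (g x) ∉ insert z P := by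
    intro h
    exact hc (mem_image.2 ⟨_, h, by simp⟩)
  have := hg _ hy
  simp at this
  rw [this] at hy
  exact hy hx

lemma Sep.slice {z p : α} {P : Finset α} {g0 g1 : Perm α} {A B F : Finset (Perm α)}
    (s : Sep z P g0 A B F) (hp : p ∈ P) (h1 : g1 ∈ X z P g0) :
    Sep z (P.erase p) g1 (A.filter (fun g => g p = g1 p)) (B.filter (fun g => g p = g1 p))
      (F.filter (fun g => g p = g1 p)) := by
  have hzp : z ≠ p := fun h => s.hz (h ▸ hp)
  constructor
  · exact fun h => s.hz (mem_of_mem_erase h)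
  · intro g hg
    rw [mem_filter] at hg
    exact (X_slice hzp hp h1).2 ⟨s.hA hg.1, hg.2⟩
  · intro g hg
    rw [mem_filter] at hg
    exact (X_slice hzp hp h1).2 ⟨s.hB hg.1, hg.2⟩
  · intro g hg
    have := (X_slice hzp hp h1).1 hg
    simp only [mem_filter, this.2, and_true]
    exact s.cov g this.1
  · intro a ha b hb k hk
    exact s.ne a (mem_filter.1 ha).1 b (mem_filter.1 hb).1 k
      (insert_subset_insert _ (erase_subset _ _) hk)

lemma swap_swap_mul (g : Perm α) (z k : α) : g * swap z k * swap z k = g := by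
  rw [mul_assoc, swap_mul_self, mul_one]

lemma Sep.symm {z : α} {P : Finset α} {g0 : Perm α} {A B F : Finset (Perm α)}
    (s : Sep z P g0 A B F) : Sep z P g0 B A F := by
  refine ⟨s.hz, s.hB, s.hA, fun g hg => ?_, ?_⟩
  · have := s.cov g hg; tauto
  · intro b hb a ha k hk h
    apply s.ne a ha b hb k hk
    rw [← h, swap_swap_mul]

lemma card_fix (Q : Finset α) :
    Q.card.factorial ≤ (univ.filter (fun σ : Perm α => ∀ x, x ∉ Q → σ x = x)).card := by
  have h := Fintype.card_congr (Equiv.Perm.subtypeEquivSubtypePerm (fun x => x ∈ Q))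
  rw [Fintype.card_perm, Fintype.card_coe, Fintype.card_subtype] at h
  exact h.le

lemma cross_count {z p : α} {P : Finset α} (hz : z ∉ P) (hp : p ∈ P) (g0 : Perm α) (i j : α)
    (hi : i ∈ (insert z P).image g0) (hj : j ∈ (insert z P).image g0) (hij : i ≠ j) :
    (P.card - 1).factorial ≤ ((X z P g0).filter (fun g => g p = i ∧ g z = j)).card := by
  have hzp : z ≠ p := fun h => hz (h ▸ hp)
  obtain ⟨s, hs, rfl⟩ := mem_image.1 hi
  obtain ⟨t, ht, rfl⟩ := mem_image.1 hj
  have hst : s ≠ t := fun h => hij (by rw [h])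
  have hu : swap z t s ∈ insert z P := by
    rw [swap_apply_def]; split_ifs <;> simp_all
  have huz : swap z t s ≠ z := by
    intro h
    rw [swap_apply_def] at h
    split_ifs at h <;> simp_all
  have hpi : p ∈ insert z P := mem_insert_of_mem hp
  set τ : Perm α := swap z t * swap p (swap z t s) with hτ
  have t1 : τ p = s := by simp [hτ]
  have t2 : τ z = t := by
    rw [hτ, Perm.mul_apply, swap_apply_of_ne_of_ne hzp huz.symm, swap_apply_left]
  have t3 : ∀ x, x ∉ insert z P → τ x = x := by
    intro x hx
    have n : ∀ y ∈ insert z P, x ≠ y := fun y hy h => hx (h ▸ hy)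
    rw [hτ, Perm.mul_apply, swap_apply_of_ne_of_ne (n p hpi) (n _ hu),
      swap_apply_of_ne_of_ne (n z (by simp)) (n t ht)]
  rw [← card_erase_of_mem hp]
  refine (card_fix _).trans ?_
  apply card_le_card_of_injOn (fun σ => g0 * τ * σ)
  · intro σ hσ
    simp only [coe_filter, mem_univ, true_and, Set.mem_setOf_eq] at hσ
    simp only [coe_filter, Set.mem_setOf_eq, mem_X, Perm.mul_apply]
    refine ⟨fun x hx => ?_, ?_, ?_⟩
    · rw [hσ x (fun h => hx (mem_insert_of_mem (mem_of_mem_erase h))), t3 x hx]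
    · rw [hσ p (by simp), t1]
    · rw [hσ z (by simp [hz]), t2]
  · intro a _ b _ h
    exact mul_left_cancel h

lemma cross {z p : α} {P : Finset α} {g0 : Perm α} {A B F : Finset (Perm α)}
    (s : Sep z P g0 A B F) (hp : p ∈ P) (S T : Finset α)
    (hS : S ⊆ (insert z P).image g0) (hT : T ⊆ (insert z P).image g0) (hST : Disjoint S T)
    (hSB : ∀ b ∈ B, b p ∉ S) (hTA : ∀ a ∈ A, a p ∉ T) :
    S.card * T.card * (P.card - 1).factorial ≤ (F.filter (fun g => g p ∈ S ∪ T)).card := by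
  have hd := Finset.disjoint_left.1 hST
  have h1 := fib ((X z P g0).filter (fun g => g p ∈ S ∧ g z ∈ T)) (fun g => (g p, g z)) (S ×ˢ T)
    ((P.card - 1).factorial) (by
      rintro ⟨i, j⟩ hij
      rw [mem_product] at hij
      refine (cross_count s.hz hp g0 i j (hS hij.1) (hT hij.2) ?_).trans (card_le_card ?_)
      · intro h
        exact hd hij.1 (by rw [show i = j from h]; exact hij.2)
      · intro g hg
        simp only [mem_filter, Prod.mk.injEq] at hg ⊢
        obtain ⟨h1, h2, h3⟩ := hg
        exact ⟨⟨h1, by rw [h2]; exact hij.1, by rw [h3]; exact hij.2⟩, h2, h3⟩)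
  rw [card_product] at h1
  refine h1.trans ?_
  have hpi : p ∈ insert z P := mem_insert_of_mem hp
  have e1 : ∀ g : Perm α, (g * swap z p) p = g z := by simp
  apply card_le_card_of_injOn (fun g => if g ∈ F then g else g * swap z p)
  · intro g hg
    simp only [coe_filter, Set.mem_setOf_eq] at hg
    obtain ⟨hX, hgS, hgT⟩ := hg
    simp only [coe_filter, Set.mem_setOf_eq]
    split_ifs with hF
    · exact ⟨hF, mem_union_left _ hgS⟩
    · rw [e1]
      refine ⟨?_, mem_union_right _ hgT⟩
      have hA : g ∈ A := by
        rcases s.cov g hX with h | h | h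
        · exact h
        · exact absurd hgS (hSB g h)
        · exact absurd h hF
      rcases s.cov _ (X_mul hX hpi) with h | h | h
      · exact absurd (by rw [e1]; exact hgT) (hTA _ h)
      · exact absurd rfl (s.ne g hA _ h p hpi)
      · exact h
  · intro g hg h hh heq
    simp only [coe_filter, Set.mem_setOf_eq] at hg hh
    simp only at heq
    split_ifs at heq with h1 h2 h2
    · exact heq
    · exfalso
      apply hd hg.2.1
      rw [heq, e1]; exact hh.2.2
    · exfalso
      apply hd hh.2.1
      rw [← heq, e1]; exact hg.2.2
    · exact mul_right_cancel heq

def Mix (p : α) (I : Finset α) (A B : Finset (Perm α)) : Finset α :=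
  I.filter (fun i => (∃ a ∈ A, a p = i) ∧ ∃ b ∈ B, b p = i)

lemma dich {z p : α} {P : Finset α} {g0 : Perm α} {A B F : Finset (Perm α)}
    (s : Sep z P g0 A B F) (hp : p ∈ P) (f : ℕ)
    (hf : ∀ i, (∃ a ∈ A, a p = i) → (∃ b ∈ B, b p = i) → f ≤ (F.filter (fun g => g p = i)).card) :
    ∃ M : Finset α, (∀ i ∈ M, (∃ a ∈ A, a p = i) ∧ ∃ b ∈ B, b p = i) ∧ M.card * f ≤ F.card ∧
      ((∀ b ∈ B, b p ∈ M) ∨ (∀ a ∈ A, a p ∈ M) ∨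
        M.card * f + (P.card - M.card) * (P.card - 1).factorial ≤ F.card) := by
  classical
  have hpi : p ∈ insert z P := mem_insert_of_mem hp
  obtain ⟨I, hI⟩ : ∃ I, I = (insert z P).image g0 := ⟨_, rfl⟩
  have hIc : I.card = P.card + 1 := by
    rw [hI, card_image_of_injective _ g0.injective, card_insert_of_notMem s.hz]
  set M := Mix p I A B with hM
  have hMI : M ⊆ I := filter_subset _ _
  have hMm : ∀ i ∈ M, (∃ a ∈ A, a p = i) ∧ ∃ b ∈ B, b p = i := fun i hi => (mem_filter.1 hi).2
  have c1 : M.card * f ≤ (F.filter (fun g => g p ∈ M)).card := by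
    apply fib _ (fun g => g p)
    intro i hi
    refine (hf i (hMm i hi).1 (hMm i hi).2).trans (card_le_card ?_)
    intro g hg
    simp only [mem_filter] at hg ⊢
    exact ⟨⟨hg.1, by rw [hg.2]; exact hi⟩, hg.2⟩
  refine ⟨M, hMm, c1.trans (card_le_card (filter_subset _ _)), ?_⟩
  set S := (I \ M).filter (fun i => ∃ a ∈ A, a p = i) with hS
  set T := (I \ M).filter (fun i => ¬ ∃ a ∈ A, a p = i) with hT
  have hcST : S.card + T.card = (I \ M).card :=
    card_filter_add_card_filter_not (s := I \ M) (fun i => ∃ a ∈ A, a p = i)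
  have hIM : (I \ M).card + M.card = I.card := card_sdiff_add_card_eq_card hMI
  have hSB : ∀ b ∈ B, b p ∉ S := by
    intro b hb h
    rw [hS, mem_filter, mem_sdiff] at h
    exact h.1.2 (mem_filter.2 ⟨h.1.1, h.2, b, hb, rfl⟩)
  have hTA : ∀ a ∈ A, a p ∉ T := by
    intro a ha h
    rw [hT, mem_filter] at h
    exact h.2 ⟨a, ha, rfl⟩
  have hIA : ∀ a ∈ A, a p ∈ I := fun a ha => hI ▸ X_val (s.hA ha) hpi
  have hIB : ∀ b ∈ B, b p ∈ I := fun a ha => hI ▸ X_val (s.hB ha) hpi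
  by_cases hTe : T.card = 0
  · left
    intro b hb
    by_contra hc
    have : b p ∉ T := by rw [card_eq_zero.1 hTe]; simp
    apply hSB b hb
    rw [hT, mem_filter] at this
    rw [hS, mem_filter]
    have h1 : b p ∈ I \ M := mem_sdiff.2 ⟨hIB b hb, hc⟩
    exact ⟨h1, by_contra fun h => this ⟨h1, h⟩⟩
  by_cases hSe : S.card = 0
  · right; left
    intro a ha
    by_contra hc
    have : a p ∈ S := mem_filter.2 ⟨mem_sdiff.2 ⟨hIA a ha, hc⟩, a, ha, rfl⟩
    rw [card_eq_zero.1 hSe] at this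
    simp at this
  right; right
  have hdST : Disjoint S T := disjoint_filter_filter_not _ _ _
  have c2 := cross s hp S T (hI ▸ (filter_subset _ _).trans sdiff_subset)
    (hI ▸ (filter_subset _ _).trans sdiff_subset) hdST hSB hTA
  have hd : Disjoint (F.filter (fun g => g p ∈ M)) (F.filter (fun g => g p ∈ S ∪ T)) := by
    rw [Finset.disjoint_filter]
    intro g _ h1 h2
    rw [mem_union, hS, hT, mem_filter, mem_filter, mem_sdiff] at h2
    tauto
  have c3 := card_le_card (union_subset (filter_subset (fun g : Perm α => g p ∈ M) F)
      (filter_subset (fun g : Perm α => g p ∈ S ∪ T) F))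
  rw [card_union_of_disjoint hd] at c3
  have c4 : P.card - M.card ≤ S.card * T.card := by
    have : P.card - M.card + 1 ≤ S.card + T.card := by omega
    obtain ⟨x, hx⟩ := Nat.exists_eq_succ_of_ne_zero hSe
    obtain ⟨y, hy⟩ := Nat.exists_eq_succ_of_ne_zero hTe
    rw [hx, hy] at this ⊢
    simp only [Nat.succ_eq_add_one] at *
    nlinarith [Nat.zero_le (x * y)]
  have c5 := Nat.mul_le_mul_right (P.card - 1).factorial c4
  omega

lemma out {z p : α} {P : Finset α} {g0 : Perm α} {A B F : Finset (Perm α)}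
    (s : Sep z P g0 A B F) (hp : p ∈ P) (J : Finset α) (hJ : ∀ b ∈ B, b p ∈ J) :
    ((NN z (P.erase p) B).filter (fun h => ¬ (h ∈ B ∧ h z ∈ J))).card ≤ F.card := by
  have hzp : z ≠ p := fun h => s.hz (h ▸ hp)
  have hpi : p ∈ insert z P := mem_insert_of_mem hp
  have e1 : ∀ g : Perm α, (g * swap z p) p = g z := by simp
  have hNJ : ∀ h ∈ NN z (P.erase p) B, h p ∈ J := by
    intro h hh
    obtain ⟨v, hv, e⟩ := NN_keep hzp hh
    rw [← e]; exact hJ v hv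
  apply card_le_card_of_injOn (fun h => if h ∈ B then h * swap z p else h)
  · intro h hh
    simp only [coe_filter, Set.mem_setOf_eq] at hh
    obtain ⟨hN, hb⟩ := hh
    simp only [mem_coe]
    split_ifs with hB
    · rcases s.cov _ (X_mul (s.hB hB) hpi) with h1 | h1 | h1
      · exact absurd (swap_swap_mul h z p) (s.ne _ h1 h hB p hpi)
      · exact absurd ⟨hB, by rw [← e1]; exact hJ _ h1⟩ hb
      · exact h1
    · obtain ⟨v, hv, k, hk, rfl⟩ := mem_NN.1 hN
      have hk' : k ∈ insert z P := insert_subset_insert _ (erase_subset _ _) hk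
      rcases s.cov _ (X_mul (s.hB hv) hk') with h1 | h1 | h1
      · exact absurd (swap_swap_mul v z k) (s.ne _ h1 v hv k hk')
      · exact absurd h1 hB
      · exact h1
  · intro g hg h hh heq
    simp only [coe_filter, Set.mem_setOf_eq] at hg hh
    simp only at heq
    split_ifs at heq with h1 h2 h2
    · exact mul_right_cancel heq
    · exfalso
      apply hg.2
      refine ⟨h1, ?_⟩
      rw [← e1, heq]; exact hNJ _ hh.1
    · exfalso
      apply hh.2
      refine ⟨h2, ?_⟩
      rw [← e1, ← heq]; exact hNJ _ hg.1
    · exact heq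

lemma out1 {z p : α} {P : Finset α} {g0 : Perm α} {A B F : Finset (Perm α)}
    (s : Sep z P g0 A B F) (hp : p ∈ P) (i : α) (hJ : ∀ b ∈ B, b p = i) :
    (NN z (P.erase p) B).card ≤ F.card := by
  have hzp : z ≠ p := fun h => s.hz (h ▸ hp)
  have := out s hp {i} (by simpa using hJ)
  rwa [filter_true_of_mem] at this
  rintro h - ⟨h1, h2⟩
  rw [mem_singleton, ← hJ h h1] at h2
  exact hzp (h.injective h2)

lemma end0 {z p : α} {P : Finset α} {g0 : Perm α} {A B F : Finset (Perm α)}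
    (s : Sep z P g0 A B F) (hp : p ∈ P) (i : α) (hJ : ∀ b ∈ B, b p = i) (hB : B.Nonempty) :
    P.card ≤ F.card := by
  obtain ⟨b, hb⟩ := hB
  have h1 := out1 s hp i hJ
  have h2 := card_le_card (cn_sub_NN (z := z) (P := P.erase p) hb)
  rw [card_cn z _ (fun h => s.hz (mem_of_mem_erase h)), card_erase_add_one hp] at h2
  omega

lemma C0 (N : ℕ) {z : α} {P : Finset α} {g0 : Perm α} {A B F : Finset (Perm α)}
    (hN : P.card = N) (s : Sep z P g0 A B F) (hA : A.Nonempty) (hB : B.Nonempty) :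
    P.card ≤ F.card ∧ 1 ≤ N := by
  induction N generalizing P g0 A B F with
  | zero =>
    exfalso
    obtain ⟨a, ha⟩ := hA
    obtain ⟨b, hb⟩ := hB
    apply s.ne a ha b hb z (by simp)
    rw [swap_one, mul_one]
    have hP := card_eq_zero.1 hN
    subst hP
    have h1 := s.hA ha
    have h2 := s.hB hb
    have v1 := X_val h1 (x := z) (by simp)
    have v2 := X_val h2 (x := z) (by simp)
    rw [mem_X] at h1 h2
    simp at v1 v2
    ext x
    by_cases hx : x = z
    · rw [hx, v1, v2]
    · rw [h1 x (by simpa using hx), h2 x (by simpa using hx)]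
  | succ N ih =>
    refine ⟨?_, by omega⟩
    obtain ⟨p, hp⟩ : P.Nonempty := by rw [← card_pos]; omega
    have hQ : (P.erase p).card = N := by rw [card_erase_of_mem hp]; omega
    have key : ∀ i, (∃ a ∈ A, a p = i) → (∃ b ∈ B, b p = i) →
        N ≤ (F.filter (fun g => g p = i)).card ∧ 1 ≤ N := by
      rintro i ⟨a, ha, rfl⟩ ⟨b, hb, hbi⟩
      have := ih hQ (s.slice hp (s.hA ha)) ⟨a, by simp [ha]⟩ ⟨b, by simp [hb, hbi]⟩
      rwa [hQ] at this
    obtain ⟨M, hM, c, d⟩ := dich s hp N (fun i h1 h2 => (key i h1 h2).1)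
    have hfac := Nat.factorial_pos N
    obtain hM0 | hM1 | hM2 : M.card = 0 ∨ M.card = 1 ∨ 2 ≤ M.card := by omega
    · rw [card_eq_zero.1 hM0] at d
      obtain ⟨a, ha⟩ := hA
      obtain ⟨b, hb⟩ := hB
      rcases d with d | d | d
      · simpa using d b hb
      · simpa using d a ha
      · rw [hN] at d ⊢
        simp at d
        nlinarith
    · obtain ⟨i, rfl⟩ := card_eq_one.1 hM1
      rcases d with d | d | d
      · exact end0 s hp i (by simpa using d) hB
      · exact end0 s.symm hp i (by simpa using d) hA
      · have := (key i (hM i (by simp)).1 (hM i (by simp)).2).2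
        rw [hN] at d ⊢
        simp at d
        nlinarith
    · obtain ⟨i, hi⟩ : M.Nonempty := by rw [← card_pos]; omega
      have := (key i (hM i hi).1 (hM i hi).2).2
      nlinarith

lemma end1 {z p : α} {P : Finset α} {g0 : Perm α} {A B F : Finset (Perm α)}
    (s : Sep z P g0 A B F) (hp : p ∈ P) (i : α) (hJ : ∀ b ∈ B, b p = i) (hB : B.Nonempty)
    (hd : ∀ b ∈ B, 1 ≤ dg z P B b) :
    2 * (P.card - 1) ≤ F.card := by
  obtain ⟨b, hb⟩ := hB
  have hzQ : z ∉ P.erase p := fun h => s.hz (mem_of_mem_erase h)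
  have h1 := out1 s hp i hJ
  obtain ⟨k, hk, hbk⟩ := one_nb (hd b hb)
  have h3 := card_edge z (P.erase p) hzQ b k (fun h => s.hz (h ▸ hk))
  have h2 := card_le_card (union_subset (cn_sub_NN (z := z) (P := P.erase p) hb)
    (cn_sub_NN (z := z) (P := P.erase p) hbk))
  rw [card_erase_of_mem hp] at h3
  omega

lemma C1 {z : α} {P : Finset α} {g0 : Perm α} {A B F : Finset (Perm α)}
    (s : Sep z P g0 A B F) (hA : A.Nonempty) (hB : B.Nonempty)
    (hdA : ∀ b ∈ A, 1 ≤ dg z P A b) (hdB : ∀ b ∈ B, 1 ≤ dg z P B b) :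
    2 * (P.card - 1) ≤ F.card := by
  obtain hP | ⟨N, hN⟩ : P.card = 0 ∨ ∃ N, P.card = N + 1 := by
    rcases P.card with _ | N
    · simp
    · right; exact ⟨N, rfl⟩
  · omega
  obtain ⟨p, hp⟩ : P.Nonempty := by rw [← card_pos]; omega
  have hQ : (P.erase p).card = N := by rw [card_erase_of_mem hp]; omega
  have key : ∀ i, (∃ a ∈ A, a p = i) → (∃ b ∈ B, b p = i) →
      N ≤ (F.filter (fun g => g p = i)).card := by
    rintro i ⟨a, ha, rfl⟩ ⟨b, hb, hbi⟩
    have := (C0 N hQ (s.slice hp (s.hA ha)) ⟨a, by simp [ha]⟩ ⟨b, by simp [hb, hbi]⟩).1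
    rwa [hQ] at this
  obtain ⟨M, hM, c, d⟩ := dich s hp N key
  have hfac := Nat.factorial_pos N
  obtain hM0 | hM1 | hM2 : M.card = 0 ∨ M.card = 1 ∨ 2 ≤ M.card := by omega
  · rw [card_eq_zero.1 hM0] at d
    obtain ⟨a, ha⟩ := hA
    obtain ⟨b, hb⟩ := hB
    rcases d with d | d | d
    · simpa using d b hb
    · simpa using d a ha
    · rw [hN] at d ⊢
      simp at d ⊢
      have : N ≤ 1 ∨ 2 ≤ N.factorial := by
        by_cases h : N ≤ 1
        · exact Or.inl h
        · right
          exact Nat.factorial_le (show 2 ≤ N by omega)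
      rcases this with h | h <;> nlinarith
  · obtain ⟨i, rfl⟩ := card_eq_one.1 hM1
    rcases d with d | d | d
    · exact end1 s hp i (by simpa using d) hB hdB
    · exact end1 s.symm hp i (by simpa using d) hA hdA
    · rw [hN] at d ⊢
      simp at d ⊢
      nlinarith
  · rw [hN]
    simp
    nlinarith

lemma part2 {z p : α} {P : Finset α} {B : Finset (Perm α)}
    (hz : z ∉ P) (hp : p ∈ P) (i j : α) (g : Perm α) (hg : g ∈ B) (hgi : g p = i)
    (hgj : g z ≠ j) (hd : 2 ≤ dg z (P.erase p) (B.filter (fun h => h p = i)) g) :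
    3 * (P.card - 2) ≤ (((NN z (P.erase p) B).filter (fun h => ¬ (h ∈ B ∧ (h z = i ∨ h z = j)))).filter
      (fun h => h p = i)).card := by
  have hzp : z ≠ p := fun h => hz (h ▸ hp)
  have hzQ : z ∉ P.erase p := fun h => hz (mem_of_mem_erase h)
  have main : ∃ k ∈ P.erase p, ∃ l ∈ P.erase p, k ≠ l ∧ g * swap z k ∈ B.filter (fun h => h p = i) ∧
      g * swap z l ∈ B.filter (fun h => h p = i) ∧
      ∃ c : Perm α, ∀ h ∈ B.filter (fun h => h p = i), h z = j →
        (h ∈ cn z (P.erase p) g ∨ h ∈ cn z (P.erase p) (g * swap z k)) → h = c := by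
    by_cases hex : ∃ k ∈ P.erase p, g k = j ∧ g * swap z k ∈ B.filter (fun h => h p = i)
    · obtain ⟨k, hk, hkj, hkB⟩ := hex
      obtain ⟨l, hl, hlk, hlB⟩ := other_nb hd k
      refine ⟨k, hk, l, hl, hlk.symm, hkB, hlB, g * swap z k, ?_⟩
      rintro h hh hhj (h1 | h1)
      · obtain ⟨m, hm, rfl⟩ := mem_cn.1 h1
        simp at hhj
        rw [← hkj] at hhj
        rw [g.injective hhj]
      · obtain ⟨m, hm, rfl⟩ := mem_cn.1 h1
        rw [Perm.mul_apply, swap_apply_left] at hhj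
        have : (g * swap z k) m = (g * swap z k) z := by rw [hhj]; simp [hkj]
        rw [(g * swap z k).injective this, swap_one, mul_one]
    · obtain ⟨k, hk, l, hl, hkl, hkB, hlB⟩ := two_nb hd
      refine ⟨k, hk, l, hl, hkl, hkB, hlB, g * swap z k * swap z ((g * swap z k).symm j), ?_⟩
      rintro h hh hhj (h1 | h1)
      · exfalso
        obtain ⟨m, hm, rfl⟩ := mem_cn.1 h1
        rw [Perm.mul_apply, swap_apply_left] at hhj
        rcases mem_insert.1 hm with rfl | hm
        · exact hgj hhj
        · exact hex ⟨m, hm, hhj, hh⟩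
      · obtain ⟨m, hm, rfl⟩ := mem_cn.1 h1
        rw [Perm.mul_apply, swap_apply_left] at hhj
        rw [← hhj, Equiv.symm_apply_apply]
  obtain ⟨k, hk, l, hl, hkl, hkB, hlB, c, hc⟩ := main
  have h3 := card_p3 z (P.erase p) hzQ g k l (fun h => hzQ (h ▸ hk)) (fun h => hzQ (h ▸ hl)) hkl
  rw [card_erase_of_mem hp] at h3
  set U := cn z (P.erase p) g ∪ cn z (P.erase p) (g * swap z k) ∪ cn z (P.erase p) (g * swap z l)
    with hU
  have hUB : ∀ v ∈ B.filter (fun h => h p = i), ∀ h ∈ cn z (P.erase p) v,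
      h ∈ NN z (P.erase p) B ∧ h p = i := by
    intro v hv h hh
    rw [mem_filter] at hv
    refine ⟨cn_sub_NN hv.1 hh, ?_⟩
    obtain ⟨k, hk, rfl⟩ := mem_cn.1 hh
    rw [keep hzp hk, hv.2]
  have hUN : ∀ h ∈ U, h ∈ NN z (P.erase p) B ∧ h p = i := by
    intro h hh
    rw [hU, mem_union, mem_union] at hh
    rcases hh with (hh | hh) | hh
    · exact hUB g (by simp [hg, hgi]) h hh
    · exact hUB _ hkB h hh
    · exact hUB _ hlB h hh
  have hbad : U.filter (fun h => h ∈ B ∧ (h z = i ∨ h z = j)) ⊆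
      {c, g * swap z l * swap z ((g * swap z l).symm j)} := by
    intro h hh
    rw [mem_filter] at hh
    obtain ⟨hhU, hhB, hij⟩ := hh
    have hpi := (hUN h hhU).2
    have hj : h z = j := by
      rcases hij with h1 | h1
      · exact absurd (h.injective (h1.trans hpi.symm)) hzp
      · exact h1
    rw [mem_insert, mem_singleton]
    rw [hU, mem_union, mem_union] at hhU
    rcases hhU with hh | hh
    · left; exact hc h (by simp [hhB, hpi]) hj hh
    · right
      obtain ⟨m, hm, rfl⟩ := mem_cn.1 hh
      rw [Perm.mul_apply, swap_apply_left] at hj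
      rw [← hj, Equiv.symm_apply_apply]
  have hb2 := (card_le_card hbad).trans card_le_two
  have hsum := card_filter_add_card_filter_not (s := U) (fun h => h ∈ B ∧ (h z = i ∨ h z = j))
  have hfin : U.filter (fun h => ¬ (h ∈ B ∧ (h z = i ∨ h z = j))) ⊆
      ((NN z (P.erase p) B).filter (fun h => ¬ (h ∈ B ∧ (h z = i ∨ h z = j)))).filter
      (fun h => h p = i) := by
    intro h hh
    rw [mem_filter] at hh
    rw [mem_filter, mem_filter]
    exact ⟨⟨(hUN h hh.1).1, hh.2⟩, (hUN h hh.1).2⟩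
  have := card_le_card hfin
  omega

lemma end2 {z p : α} {P : Finset α} {g0 : Perm α} {A B F : Finset (Perm α)}
    (s : Sep z P g0 A B F) (hp : p ∈ P) (i j : α) (hij : i ≠ j) (hJ : ∀ b ∈ B, b p = i ∨ b p = j)
    (hi : ∃ b ∈ B, b p = i) (hj : ∃ b ∈ B, b p = j)
    (hd : ∀ b ∈ B, 2 ≤ dg z P B b) :
    6 * (P.card - 2) ≤ F.card := by
  have o := out s hp {i, j} (by simpa using hJ)
  simp only [mem_insert, mem_singleton] at o
  obtain ⟨a, ha, hai⟩ := hi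
  obtain ⟨b, hb, hbj⟩ := hj
  obtain ⟨g, hg, h1, h2, h3, h4⟩ := exists_out s.hz hp B hd i j hJ a ha hai
  obtain ⟨g', hg', h1', h2', h3', h4'⟩ := exists_out s.hz hp B hd j i (fun g hg => (hJ g hg).symm) b hb hbj
  have p1 := part2 s.hz hp i j g hg h1 h3 h4
  have p2 := part2 s.hz hp j i g' hg' h1' h3' h4'
  simp only [or_comm (b := _ = i)] at p2
  set W := (NN z (P.erase p) B).filter (fun h => ¬ (h ∈ B ∧ (h z = i ∨ h z = j))) with hW
  have hdj : Disjoint (W.filter (fun h => h p = i)) (W.filter (fun h => h p = j)) := by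
    rw [Finset.disjoint_filter]
    intro x _ h1 h2
    exact hij (h1.symm.trans h2)
  have c := card_le_card (union_subset (filter_subset (fun h => h p = i) W)
      (filter_subset (fun h => h p = j) W))
  rw [card_union_of_disjoint hdj] at c
  omega

lemma end3 {z p : α} {P : Finset α} {g0 : Perm α} {A B F : Finset (Perm α)}
    (s : Sep z P g0 A B F) (hp : p ∈ P) (i : α) (hJ : ∀ b ∈ B, b p = i) (hB : B.Nonempty)
    (hd : ∀ b ∈ B, 2 ≤ dg z P B b) :
    6 * (P.card - 2) ≤ F.card := by
  have hzp : z ≠ p := fun h => s.hz (h ▸ hp)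
  have hzQ : z ∉ P.erase p := fun h => s.hz (mem_of_mem_erase h)
  have hK' : ∀ g ∈ B, 2 ≤ dg z (P.erase p) B g := by
    intro g hg
    refine (hd g hg).trans ((dg_slice' s.hz hp B g ?_).trans (dg_mono (filter_subset _ _) g))
    intro h
    have := hJ _ h
    rw [← hJ g hg] at this
    simp at this
    exact hzp this
  have h1 := out1 s hp i hJ
  have h2 := L z (P.erase p) hzQ B hB hK'
  rw [card_erase_of_mem hp] at h2
  omega

lemma C2 {z : α} {P : Finset α} {g0 : Perm α} {A B F : Finset (Perm α)}
    (s : Sep z P g0 A B F) (hA : A.Nonempty) (hB : B.Nonempty)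
    (hdA : ∀ b ∈ A, 2 ≤ dg z P A b) (hdB : ∀ b ∈ B, 2 ≤ dg z P B b) :
    6 * (P.card - 2) ≤ F.card := by
  obtain hP | ⟨N, hN⟩ : P.card ≤ 2 ∨ ∃ N, P.card = N + 3 := by
    by_cases h : P.card ≤ 2
    · exact Or.inl h
    · exact Or.inr ⟨P.card - 3, by omega⟩
  · omega
  obtain ⟨p, hp⟩ : P.Nonempty := by rw [← card_pos]; omega
  have hQ : (P.erase p).card = N + 2 := by rw [card_erase_of_mem hp]; omega
  have key : ∀ i, (∃ a ∈ A, a p = i) → (∃ b ∈ B, b p = i) →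
      2 * (N + 1) ≤ (F.filter (fun g => g p = i)).card := by
    rintro i ⟨a, ha, rfl⟩ ⟨b, hb, hbi⟩
    have dd : ∀ K : Finset (Perm α), (∀ b ∈ K, 2 ≤ dg z P K b) →
        ∀ b ∈ K.filter (fun g => g p = a p), 1 ≤ dg z (P.erase p) (K.filter (fun g => g p = a p)) b := by
      intro K hK b hb
      rw [mem_filter] at hb
      have h1 := dg_slice s.hz hp K b
      rw [hb.2] at h1
      have := hK b hb.1
      omega
    have := C1 (s.slice hp (s.hA ha)) ⟨a, by simp [ha]⟩ ⟨b, by simp [hb, hbi]⟩ (dd A hdA) (dd B hdB)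
    rwa [hQ] at this
  obtain ⟨M, hM, c, d⟩ := dich s hp _ key
  have hfac : 2 ≤ (N + 2).factorial := Nat.factorial_le (show 2 ≤ N + 2 by omega)
  have hfac2 : N = 0 ∨ 6 ≤ (N + 2).factorial := by
    by_cases h : N = 0
    · exact Or.inl h
    · right
      exact Nat.factorial_le (show 3 ≤ N + 2 by omega)
  rw [hN] at d
  simp only [Nat.add_succ_sub_one] at d
  generalize (N + 2).factorial = f at *
  obtain hM0 | hM1 | hM2 | hM3 : M.card = 0 ∨ M.card = 1 ∨ M.card = 2 ∨ 3 ≤ M.card := by omega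
  · rw [card_eq_zero.1 hM0] at d
    obtain ⟨a, ha⟩ := hA
    obtain ⟨b, hb⟩ := hB
    rcases d with d | d | d
    · simpa using d b hb
    · simpa using d a ha
    · rw [hN]
      simp at d ⊢
      rcases hfac2 with rfl | h <;> nlinarith
  · obtain ⟨i, rfl⟩ := card_eq_one.1 hM1
    rcases d with d | d | d
    · exact end3 s hp i (by simpa using d) hB hdB
    · exact end3 s.symm hp i (by simpa using d) hA hdA
    · rw [hN]
      simp at d ⊢
      rcases hfac2 with rfl | h <;> nlinarith
  · obtain ⟨i, j, hij, rfl⟩ := card_eq_two.1 hM2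
    have hi := hM i (by simp)
    have hj := hM j (by simp)
    rcases d with d | d | d
    · exact end2 s hp i j hij (by simpa using d) hi.2 hj.2 hdB
    · exact end2 s.symm hp i j hij (by simpa using d) hi.1 hj.1 hdA
    · rw [hN]
      rw [hM2] at d
      simp at d ⊢
      nlinarith
  · rw [hN]
    simp
    nlinarith

/-- the generating set of the star graph -/
def TT {n : ℕ} (z : Fin n) : Set (Perm (Fin n)) := {t | ∃ i : Fin n, i ≠ z ∧ t = swap z i}

lemma adj_iff {n : ℕ} (z : Fin n) (g h : Perm (Fin n)) :
    (cayley (TT z)).Adj g h ↔ ∃ k, k ≠ z ∧ h = g * swap z k := by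
  simp only [cayley, SimpleGraph.fromRel_adj, TT, Set.mem_setOf_eq]
  constructor
  · rintro ⟨-, ⟨t, ⟨i, hi, rfl⟩, h1⟩ | ⟨t, ⟨i, hi, rfl⟩, h1⟩⟩
    · exact ⟨i, hi, h1⟩
    · exact ⟨i, hi, by rw [h1, swap_swap_mul]⟩
  · rintro ⟨k, hk, rfl⟩
    refine ⟨?_, Or.inl ⟨_, ⟨k, hk, rfl⟩, rfl⟩⟩
    intro h
    have := congrArg (fun f : Perm (Fin n) => f z) h
    simp at this
    exact hk this.symm

lemma lower {n : ℕ} (hn : 4 ≤ n) (z : Fin n) (F : Set (Perm (Fin n)))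
    (hF : IsRkCut (cayley (TT z)) 2 F) : 6 * (n - 3) ≤ F.ncard := by
  classical
  obtain ⟨hc, hdeg⟩ := hF
  by_cases hne : (Fᶜ : Set (Perm (Fin n))).Nonempty
  swap
  · have : F = Set.univ := by
      rw [Set.not_nonempty_iff_eq_empty] at hne
      simpa using hne
    rw [this, Set.ncard_univ, Nat.card_eq_fintype_card, Fintype.card_perm, Fintype.card_fin]
    obtain ⟨m, rfl⟩ : ∃ m, n = m + 4 := ⟨n - 4, by omega⟩
    have h1 : Nat.factorial 3 ≤ Nat.factorial (m + 3) := Nat.factorial_le (by omega)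
    rw [show Nat.factorial 3 = 6 from rfl] at h1
    rw [Nat.factorial_succ (m + 3)]
    have : m + 4 - 3 = m + 1 := by omega
    rw [this]
    nlinarith
  have hpre : ¬ ((cayley (TT z)).induce (Fᶜ : Set (Perm (Fin n)))).Preconnected := by
    intro h
    haveI := hne.to_subtype
    exact hc ⟨h⟩
  simp only [SimpleGraph.Preconnected, not_forall] at hpre
  obtain ⟨⟨a, ha⟩, ⟨b, hb⟩, hab⟩ := hpre
  set R : Perm (Fin n) → Prop := fun g => ∃ h : g ∈ (Fᶜ : Set (Perm (Fin n))),
    ((cayley (TT z)).induce (Fᶜ : Set (Perm (Fin n)))).Reachable ⟨a, ha⟩ ⟨g, h⟩ with hR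
  have step : ∀ g h, R g → h ∉ F → (cayley (TT z)).Adj g h → R h := by
    rintro g h ⟨hg, hr⟩ hh hadj
    refine ⟨hh, hr.trans ?_⟩
    apply SimpleGraph.Adj.reachable
    exact hadj
  set A : Finset (Perm (Fin n)) := univ.filter R with hA
  set B : Finset (Perm (Fin n)) := univ.filter (fun g => g ∉ F ∧ ¬ R g) with hB
  have hmA : ∀ g, g ∈ A ↔ R g := by simp [hA]
  have hmB : ∀ g, g ∈ B ↔ g ∉ F ∧ ¬ R g := by simp [hB]
  have hz : z ∉ (univ.erase z : Finset (Fin n)) := by simp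
  have hX : ∀ g, g ∈ X z (univ.erase z) 1 := by
    intro g; rw [mem_X]; intro x hx
    simp at hx
  have sep : Sep z (univ.erase z) 1 A B F.toFinset := by
    refine ⟨hz, fun g _ => hX g, fun g _ => hX g, ?_, ?_⟩
    · intro g _
      rw [hmA, hmB, Set.mem_toFinset]
      tauto
    · intro g hg h hh k hk e
      rw [hmA] at hg
      rw [hmB] at hh
      by_cases hkz : k = z
      · rw [hkz, swap_one, mul_one] at e
        subst e; exact hh.2 hg
      · exact hh.2 (step g h hg hh.1 ((adj_iff z g h).2 ⟨k, hkz, e.symm⟩))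
  have deg : ∀ (K : Finset (Perm (Fin n))) (g : Perm (Fin n)), g ∉ F →
      (∀ h, h ∉ F → (cayley (TT z)).Adj g h → h ∈ K) → 2 ≤ dg z (univ.erase z) K g := by
    intro K g hg hK
    refine (hdeg g hg).trans ?_
    unfold dg
    rw [← card_image_of_injective _ (show Function.Injective (fun k => g * swap z k) from
      fun x y h => swap_inj z (mul_left_cancel h)), ← Set.ncard_coe_finset]
    apply Set.ncard_le_ncard _ (Set.toFinite _)
    rintro h ⟨h1, h2⟩
    obtain ⟨k, hk, rfl⟩ := (adj_iff z g h).1 h2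
    simp only [coe_image, Set.mem_image, mem_coe, mem_filter]
    exact ⟨k, ⟨by simp [hk], hK _ h1 h2⟩, rfl⟩
  have := C2 sep ⟨a, (hmA a).2 ⟨ha, SimpleGraph.Reachable.refl _⟩⟩
    ⟨b, (hmB b).2 ⟨hb, fun ⟨_, h⟩ => hab h⟩⟩
    (by
      intro g hg
      rw [hmA] at hg
      exact deg A g hg.1 (fun h h1 h2 => (hmA h).2 (step g h hg h1 h2)))
    (by
      intro g hg
      rw [hmB] at hg
      refine deg B g hg.1 (fun h h1 h2 => (hmB h).2 ⟨h1, fun h3 => hg.2 ?_⟩)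
      exact step h g h3 hg.1 h2.symm)
  rw [card_erase_of_mem (mem_univ z), card_univ, Fintype.card_fin, ← Set.ncard_eq_toFinset_card'] at this
  omega

lemma upper {n : ℕ} (hn : 4 ≤ n) (z : Fin n) :
    ∃ F : Set (Perm (Fin n)), IsRkCut (cayley (TT z)) 2 F ∧ F.ncard ≤ 6 * (n - 3) := by
  classical
  -- three more points
  obtain ⟨W, hW, hWc⟩ := exists_subset_card_eq (s := (univ.erase z : Finset (Fin n))) (n := 3) (by
    rw [card_erase_of_mem (mem_univ z), card_univ, Fintype.card_fin]; omega)
  obtain ⟨u, v, w, huv, huw, hvw, rfl⟩ := card_eq_three.1 hWc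
  have hu : u ≠ z := by have := @hW u (by simp); simpa using this
  have hv : v ≠ z := by have := @hW v (by simp); simpa using this
  have hw : w ≠ z := by have := @hW w (by simp); simpa using this
  set D : Finset (Fin n) := {z, u, v} with hD
  have hDc : D.card = 3 := card_eq_three.2 ⟨z, u, v, hu.symm, hv.symm, huv, rfl⟩
  set C : Finset (Perm (Fin n)) := univ.filter (fun g => ∀ x, x ∉ D → g x = x) with hC
  have hCm : ∀ g, g ∈ C ↔ ∀ x, x ∉ D → g x = x := by simp [hC]
  have hCD : ∀ g ∈ C, ∀ x ∈ D, g x ∈ D := by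
    intro g hg x hx
    rw [hCm] at hg
    by_contra hc
    have := g.injective (hg _ hc)
    rw [this] at hc
    exact hc hx
  have hCc : C.card = 6 := by
    have h := Fintype.card_congr (Equiv.Perm.subtypeEquivSubtypePerm (fun x => x ∈ D))
    rw [Fintype.card_perm, Fintype.card_coe, Fintype.card_subtype, hDc] at h
    exact h.symm
  set FF : Finset (Perm (Fin n)) := (C ×ˢ (univ \ D)).image (fun q => q.1 * swap z q.2) with hFF
  have hFm : ∀ g, g ∈ FF ↔ ∃ c ∈ C, ∃ i, i ∉ D ∧ c * swap z i = g := by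
    intro g
    simp only [hFF, mem_image, mem_product, mem_sdiff, mem_univ, true_and, Prod.exists]
    constructor
    · rintro ⟨c, i, ⟨h1, h2⟩, h3⟩; exact ⟨c, h1, i, h2, h3⟩
    · rintro ⟨c, h1, i, h2, h3⟩; exact ⟨c, i, ⟨h1, h2⟩, h3⟩
  have hzD : z ∈ D := by simp [hD]
  have huD : u ∈ D := by simp [hD]
  have hvD : v ∈ D := by simp [hD]
  have hwD : w ∉ D := by simp [hD, hw, huw.symm, hvw.symm]
  -- value at z of elements of F
  have hFz : ∀ g ∈ FF, g z ∉ D := by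
    intro g hg
    obtain ⟨c, hc, i, hi, rfl⟩ := (hFm g).1 hg
    rw [Perm.mul_apply, swap_apply_left, (hCm c).1 hc i hi]
    exact hi
  have hCF : ∀ g ∈ C, g ∉ FF := fun g hg h => hFz g h (hCD g hg z hzD)
  have hCmul : ∀ g ∈ C, ∀ k ∈ D, g * swap z k ∈ C := by
    intro g hg k hk
    rw [hCm] at hg ⊢
    intro x hx
    rw [Perm.mul_apply, swap_apply_of_ne_of_ne, hg x hx]
    · rintro rfl; exact hx hzD
    · rintro rfl; exact hx hk
  have huniq : ∀ g, g ∉ C → ∀ k l, k ≠ z → l ≠ z → g * swap z k ∈ FF → g * swap z l ∈ FF → k = l := by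
    intro g hg k l hk hl h1 h2
    obtain ⟨c, hc, i, hi, e1⟩ := (hFm _).1 h1
    obtain ⟨d, hd, j, hj, e2⟩ := (hFm _).1 h2
    have iz : i ≠ z := fun h => hi (h ▸ hzD)
    have jz : j ≠ z := fun h => hj (h ▸ hzD)
    have f1 : g = c * swap z i * swap z k := by rw [e1, swap_swap_mul]
    have f2 : g = d * swap z j * swap z l := by rw [e2, swap_swap_mul]
    have ki : k ≠ i := by
      rintro rfl
      rw [swap_swap_mul] at f1
      exact hg (f1 ▸ hc)
    have lj : l ≠ j := by
      rintro rfl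
      rw [swap_swap_mul] at f2
      exact hg (f2 ▸ hd)
    have c1 := (hCm c).1 hc
    have d1 := (hCm d).1 hd
    have c2 := hCD c hc
    have d2 := hCD d hd
    have v1 : ∀ x, g x = c (swap z i (swap z k x)) := by intro x; rw [f1]; rfl
    have v2 : ∀ x, g x = d (swap z j (swap z l x)) := by intro x; rw [f2]; rfl
    by_contra hkl
    have a1 : g z = c k := by
      rw [v1, swap_apply_left, swap_apply_of_ne_of_ne hk ki]
    have a2 : g z = d l := by
      rw [v2, swap_apply_left, swap_apply_of_ne_of_ne hl lj]
    have b1 : g k = i := by rw [v1, swap_apply_right, swap_apply_left, c1 i hi]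
    have b2 : g l = j := by rw [v2, swap_apply_right, swap_apply_left, d1 j hj]
    have b3 : g i = c z := by
      rw [v1, swap_apply_of_ne_of_ne iz ki.symm, swap_apply_right]
    have hij : i ≠ j := by
      rintro rfl
      exact hkl (g.injective (b1.trans b2.symm))
    by_cases kD : k ∈ D
    · have hgz : g z ∈ D := a1 ▸ c2 k kD
      have lD : l ∈ D := by
        by_contra h
        rw [a2, d1 l h] at hgz
        exact h hgz
      have il : i ≠ l := fun h => hi (h ▸ lD)
      have b4 : g i = i := by
        rw [v2, swap_apply_of_ne_of_ne iz il, swap_apply_of_ne_of_ne iz hij, d1 i hi]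
      apply hi
      rw [← b4, b3]
      exact c2 z hzD
    · have lD : l ∉ D := by
        intro h
        have := d2 l h
        rw [← a2, a1, c1 k kD] at this
        exact kD this
      rw [a1, c1 k kD, d1 l lD] at a2
      exact hkl a2
  have two : ∀ g k l, k ≠ z → l ≠ z → k ≠ l → g * swap z k ∉ FF → g * swap z l ∉ FF →
      2 ≤ {h | h ∉ (FF : Set (Perm (Fin n))) ∧ (cayley (TT z)).Adj g h}.ncard := by
    intro g k l hk hl hkl h1 h2
    have : ({g * swap z k, g * swap z l} : Set (Perm (Fin n))) ⊆
        {h | h ∉ (FF : Set (Perm (Fin n))) ∧ (cayley (TT z)).Adj g h} := by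
      rintro h (rfl | rfl)
      · exact ⟨by simpa using h1, (adj_iff z _ _).2 ⟨k, hk, rfl⟩⟩
      · exact ⟨by simpa using h2, (adj_iff z _ _).2 ⟨l, hl, rfl⟩⟩
    refine le_trans (le_of_eq ?_) (Set.ncard_le_ncard this (Set.toFinite _))
    rw [Set.ncard_pair]
    exact fun h => hkl (swap_inj z (mul_left_cancel h))
  refine ⟨(FF : Set (Perm (Fin n))), ⟨?_, ?_⟩, ?_⟩
  · intro hcon
    have h1C : (1 : Perm (Fin n)) ∈ C := by rw [hCm]; simp
    have hsF : swap u w ∉ FF := by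
      intro h
      apply hFz _ h
      rw [swap_apply_of_ne_of_ne hu.symm hw.symm]
      exact hzD
    have hsC : swap u w ∉ C := by
      intro h
      have := (hCm _).1 h w hwD
      rw [swap_apply_right] at this
      exact huw this
    have hr := hcon.preconnected ⟨1, by simpa using hCF 1 h1C⟩ ⟨swap u w, by simpa using hsF⟩
    obtain ⟨wk⟩ := hr
    have all : ∀ (x y : ((FF : Set (Perm (Fin n)))ᶜ : Set (Perm (Fin n)))),
        ((cayley (TT z)).induce ((FF : Set (Perm (Fin n)))ᶜ)).Walk x y → x.1 ∈ C → y.1 ∈ C := by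
      intro x y wk
      induction wk with
      | nil => exact id
      | cons hadj wk2 ih =>
        rename_i x y y2
        intro hx
        apply ih
        obtain ⟨k, hk, e⟩ := (adj_iff z x.1 y.1).1 hadj
        by_cases kD : k ∈ D
        · rw [e]; exact hCmul _ hx k kD
        · exfalso
          apply y.2
          rw [mem_coe, hFm]
          exact ⟨x.1, hx, k, kD, e.symm⟩
    exact hsC (all _ _ wk h1C)
  · intro g hg
    by_cases hgC : g ∈ C
    · exact two g u v hu hv huv (hCF _ (hCmul g hgC u huD)) (hCF _ (hCmul g hgC v hvD))
    · have q := huniq g hgC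
      by_cases h1 : g * swap z u ∈ FF
      · exact two g v w hv hw hvw (fun h => huv (q u v hu hv h1 h)) (fun h => huw (q u w hu hw h1 h))
      · by_cases h2 : g * swap z v ∈ FF
        · exact two g u w hu hw huw h1 (fun h => hvw (q v w hv hw h2 h))
        · exact two g u v hu hv huv h1 h2
  · rw [Set.ncard_coe_finset]
    refine card_image_le.trans ?_
    rw [card_product, hCc, card_sdiff_of_subset (subset_univ _), hDc, card_univ, Fintype.card_fin]

end StarAux

/-- For `n ≥ 4`, the `R_2`-vertex-connectivity of the star graph `S_n` (the Cayley
graph of the transpositions `(1 i)`, `2 ≤ i ≤ n`) equals `6(n-3)`. -/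
theorem stmt16 (n : ℕ) (hn : 4 ≤ n) :
    rkConn (cayley {t : Equiv.Perm (Fin n) |
        ∃ i : Fin n, i ≠ ⟨0, by omega⟩ ∧ t = Equiv.swap ⟨0, by omega⟩ i}) 2
      = 6 * (n - 3) := by
  have key : rkConn (cayley (StarAux.TT (⟨0, by omega⟩ : Fin n))) 2 = 6 * (n - 3) := by
    obtain ⟨F, hF, hc⟩ := StarAux.upper hn (⟨0, by omega⟩ : Fin n)
    apply le_antisymm
    · refine le_trans ?_ hc
      unfold rkConn
      exact Nat.sInf_le ⟨F, hF, rfl⟩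
    · obtain ⟨F', hF', e⟩ := Nat.sInf_mem (s := {m : ℕ | ∃ F : Set (Equiv.Perm (Fin n)),
        IsRkCut (cayley (StarAux.TT (⟨0, by omega⟩ : Fin n))) 2 F ∧ F.ncard = m}) ⟨_, F, hF, rfl⟩
      unfold rkConn
      rw [← e]
      exact StarAux.lower hn _ F' hF'
  exact key
end

section
/- Let n ≥ 5 and let 𝒯 be a set of transpositions of Sym(n) whose transposition generating graph G(𝒯) is a tree on n vertices that is not a star (not all edges share a common vertex). Then the R_2-vertex-connectivity of Cay(Sym(n),𝒯) satisfies κ^2(Cay(Sym(n),𝒯)) = 4n − 12. -/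
/-- Numerical profile of a separation, split according to the value at a leaf. -/
structure Prof {ι : Type*} [DecidableEq ι] (I : Finset ι) (n p : ℕ) (a b f : ι → ℕ) : Prop where
  card : I.card = n
  tot : ∀ i ∈ I, a i + b i + f i = (n - 1) * p
  c1 : ∀ i ∈ I, 1 ≤ a i → 1 ≤ b i → n ≤ f i + 2
  c2 : ∀ i ∈ I, 2 ≤ a i → 2 ≤ b i → 2 * n ≤ f i + 6
  c3 : ∀ i ∈ I, 3 ≤ a i → 3 ≤ b i → 3 * n ≤ f i + 11
  c4 : ∀ i ∈ I, 4 ≤ a i → 4 ≤ b i → 4 * n ≤ f i + 17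
  hx : ∀ P Q : Finset ι, P ⊆ I → Q ⊆ I → Disjoint P Q →
    P.card * Q.card * p ≤ ∑ i ∈ P, (f i + b i) + ∑ i ∈ Q, (f i + a i)
  hb : ∀ i ∈ I, b i ≤ ∑ j ∈ I.erase i, (f j + b j)
  ha : ∀ i ∈ I, a i ≤ ∑ j ∈ I.erase i, (f j + a j)

namespace Prof

set_option linter.unusedSectionVars false

variable {ι : Type*} [DecidableEq ι] {I : Finset ι} {n p : ℕ} {a b f : ι → ℕ}

lemma symm (h : Prof I n p a b f) : Prof I n p b a f where
  card := h.card
  tot i hi := by have := h.tot i hi; omega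
  c1 i hi x y := h.c1 i hi y x
  c2 i hi x y := h.c2 i hi y x
  c3 i hi x y := h.c3 i hi y x
  c4 i hi x y := h.c4 i hi y x
  hx P Q hP hQ hd := by
    have := h.hx Q P hQ hP hd.symm
    rw [mul_comm P.card, add_comm]; exact this
  hb := h.ha
  ha := h.hb

/-- All parts in `J` have the same type. -/
lemma type (h : Prof I n p a b f) (J : Finset ι) (hJ : J ⊆ I) (k : ℕ)
    (hk : ∀ j ∈ J, (b j ≤ k ∧ 2 * b j ≤ f j) ∨ (a j ≤ k ∧ 2 * a j ≤ f j))
    (hlt : 3 * ∑ j ∈ J, f j < 2 * ((J.card - 1) * p)) :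
    (∀ j ∈ J, b j ≤ k) ∨ (∀ j ∈ J, a j ≤ k) := by
  set P := J.filter (fun j => b j ≤ k ∧ 2 * b j ≤ f j) with hP
  set Q := J.filter (fun j => ¬ (b j ≤ k ∧ 2 * b j ≤ f j)) with hQ
  have hPQ : P.card + Q.card = J.card := Finset.card_filter_add_card_filter_not _
  have hQa : ∀ j ∈ Q, a j ≤ k ∧ 2 * a j ≤ f j := by
    intro j hj
    rw [hQ, Finset.mem_filter] at hj
    exact (hk j hj.1).resolve_left hj.2
  have hPb : ∀ j ∈ P, b j ≤ k ∧ 2 * b j ≤ f j := by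
    intro j hj
    rw [hP, Finset.mem_filter] at hj
    exact hj.2
  have hx := h.hx P Q ((Finset.filter_subset _ _).trans hJ) ((Finset.filter_subset _ _).trans hJ)
    (Finset.disjoint_filter_filter_not _ _ _)
  have hs : ∑ j ∈ P, f j + ∑ j ∈ Q, f j = ∑ j ∈ J, f j := Finset.sum_filter_add_sum_filter_not _ _ _
  have h1 : 2 * ∑ i ∈ P, (f i + b i) ≤ 3 * ∑ i ∈ P, f i := by
    rw [Finset.mul_sum, Finset.mul_sum]
    exact Finset.sum_le_sum (fun i hi => by have := hPb i hi; omega)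
  have h2 : 2 * ∑ i ∈ Q, (f i + a i) ≤ 3 * ∑ i ∈ Q, f i := by
    rw [Finset.mul_sum, Finset.mul_sum]
    exact Finset.sum_le_sum (fun i hi => by have := hQa i hi; omega)
  have h3 : P.card * Q.card * p < (J.card - 1) * p := by omega
  have h4 : P.card * Q.card < J.card - 1 := lt_of_mul_lt_mul_right h3 (Nat.zero_le _)
  have h5 : P.card = 0 ∨ Q.card = 0 := by
    by_contra hc
    push Not at hc
    obtain ⟨x, hx⟩ := Nat.exists_eq_succ_of_ne_zero hc.1
    obtain ⟨y, hy⟩ := Nat.exists_eq_succ_of_ne_zero hc.2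
    rw [← hPQ, hx, hy] at h4
    simp only [Nat.succ_eq_add_one] at h4
    have : (x + 1) * (y + 1) = x * y + x + y + 1 := by ring
    have := Nat.zero_le (x * y)
    omega
  rcases h5 with h5 | h5
  · right
    intro j hj
    have : j ∉ P := by rw [Finset.card_eq_zero.1 h5]; simp
    exact (hQa j (by rw [hQ, Finset.mem_filter]; rw [hP, Finset.mem_filter] at this; tauto)).1
  · left
    intro j hj
    have : j ∉ Q := by rw [Finset.card_eq_zero.1 h5]; simp
    exact (hPb j (by rw [hQ, Finset.mem_filter] at this; rw [hP, Finset.mem_filter]; tauto)).1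

lemma sum_two {i j : ι} (hi : i ∈ I) (hj : j ∈ I) (hij : i ≠ j) : f i + f j ≤ ∑ x ∈ I, f x := by
  rw [← Finset.sum_pair hij]
  exact Finset.sum_le_sum_of_subset (by intro x; simp; rintro (rfl | rfl) <;> assumption)

lemma sum_one {i : ι} (hi : i ∈ I) : f i ≤ ∑ x ∈ I, f x :=
  Finset.single_le_sum (fun _ _ => Nat.zero_le _) hi

/-- Everything off `i` is of one type: conclude that the small side is inside part `i`. -/
lemma inside (h : Prof I n p a b f) {i : ι} (hi : i ∈ I)
    (h0 : ∀ j ∈ I.erase i, b j = 0) :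
    b i = ∑ j ∈ I, b j ∧ f i + b i ≤ ∑ j ∈ I, f j := by
  have h1 := h.hb i hi
  rw [Finset.sum_add_distrib, Finset.sum_eq_zero h0] at h1
  have h2 := Finset.add_sum_erase I f hi
  have h3 := Finset.add_sum_erase I b hi
  rw [Finset.sum_eq_zero h0] at h3
  omega

lemma claim1 (h : Prof I n p a b f) (hn : 2 ≤ n) (hp : 1 ≤ p) (hp2 : n = 2 → p = 1)
    (hp4 : 4 ≤ n → 2 ≤ p)
    (sa : 1 ≤ ∑ i ∈ I, a i) (sb : 1 ≤ ∑ i ∈ I, b i) : n ≤ ∑ i ∈ I, f i + 1 := by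
  by_contra hlt
  push Not at hlt
  by_cases hm : ∃ i ∈ I, 1 ≤ a i ∧ 1 ≤ b i
  · obtain ⟨i, hi, hai, hbi⟩ := hm
    have h1 := h.c1 i hi hai hbi
    have h2 := Finset.add_sum_erase I f hi
    have h3 : ∑ j ∈ I.erase i, f j = 0 := by omega
    have h4 : ∀ j ∈ I.erase i, f j = 0 := fun j hj => by
      have := sum_one (f := f) hj; omega
    have hn3 : 3 ≤ n := by
      by_contra hc
      have : n = 2 := by omega
      have := hp2 this
      have := h.tot i hi
      subst n; subst p; omega
    have hp' : 1 ≤ (n - 2) * p := Nat.one_le_iff_ne_zero.2 (Nat.mul_ne_zero (by omega) (by omega))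
    have ht := h.type (I.erase i) (Finset.erase_subset _ _) 0 (by
      intro j hj
      by_contra hc
      have hjI := Finset.mem_of_mem_erase hj
      have := h.c1 j hjI (by omega) (by omega)
      have := h4 j hj
      omega) (by
      rw [h3, Finset.card_erase_of_mem hi, h.card, show n - 1 - 1 = n - 2 by omega]; omega)
    rcases ht with ht | ht
    · have := h.inside hi (fun j hj => Nat.le_zero.1 (ht j hj)); omega
    · have := h.symm.inside hi (fun j hj => Nat.le_zero.1 (ht j hj)); omega
  · push Not at hm
    have ht := h.type I (subset_refl _) 0 (by
      intro j hj
      have := hm j hj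
      by_cases hb : b j = 0 <;> omega) (by
        rw [h.card]
        have : (n - 1) * 1 ≤ (n - 1) * p := Nat.mul_le_mul_left _ hp
        have h5 : n ≤ 3 ∨ 4 ≤ n := by omega
        have h6 : 3 * ∑ j ∈ I, f j ≤ 3 * (n - 2) := by omega
        by_cases hp1 : 2 ≤ p
        · have : (n - 1) * 2 ≤ (n - 1) * p := Nat.mul_le_mul_left _ hp1
          omega
        · omega)
    rcases ht with ht | ht
    · rw [Finset.sum_eq_zero (fun j hj => Nat.le_zero.1 (ht j hj))] at sb; omega
    · rw [Finset.sum_eq_zero (fun j hj => Nat.le_zero.1 (ht j hj))] at sa; omega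

lemma low1 (h : Prof I n p a b f) (hn : 4 ≤ n) (hp : 2 ≤ p) {j : ι} (hj : j ∈ I)
    (h1 : b j = 1) : n ≤ f j + 2 := by
  by_cases ha : 1 ≤ a j
  · exact h.c1 j hj ha (by omega)
  · have := h.tot j hj
    have : (n - 1) * 2 ≤ (n - 1) * p := Nat.mul_le_mul_left _ hp
    omega

lemma low2 (h : Prof I n p a b f) (hn : 5 ≤ n) (hp : 6 ≤ p) {j : ι} (hj : j ∈ I)
    (h1 : b j = 2) : 2 * n ≤ f j + 6 := by
  by_cases ha : 2 ≤ a j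
  · exact h.c2 j hj ha (by omega)
  · have := h.tot j hj
    have : (n - 1) * 6 ≤ (n - 1) * p := Nat.mul_le_mul_left _ hp
    omega

lemma claim2 (h : Prof I n p a b f) (hn : 4 ≤ n) (hp : 2 ≤ p) (hp' : n ≤ p + 2)
    (sa : 2 ≤ ∑ i ∈ I, a i) (sb : 2 ≤ ∑ i ∈ I, b i) : 2 * n ≤ ∑ i ∈ I, f i + 4 := by
  by_contra hlt
  push Not at hlt
  by_cases hm : ∃ i ∈ I, 2 * n ≤ f i + 6
  · obtain ⟨i, hi, hfi⟩ := hm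
    have h2 := Finset.add_sum_erase I f hi
    have h3 : ∑ j ∈ I.erase i, f j ≤ 1 := by omega
    have h4 : ∀ j ∈ I.erase i, f j ≤ 1 := fun j hj => by
      have := sum_one (f := f) hj; omega
    have ht := h.type (I.erase i) (Finset.erase_subset _ _) 0 (by
      intro j hj
      by_contra hc
      have hjI := Finset.mem_of_mem_erase hj
      have := h.c1 j hjI (by omega) (by omega)
      have := h4 j hj
      omega) (by
      rw [Finset.card_erase_of_mem hi, h.card, show n - 1 - 1 = n - 2 by omega]
      have : (n - 2) * 2 ≤ (n - 2) * p := Nat.mul_le_mul_left _ hp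
      omega)
    rcases ht with ht | ht
    · have := h.inside hi (fun j hj => Nat.le_zero.1 (ht j hj)); omega
    · have := h.symm.inside hi (fun j hj => Nat.le_zero.1 (ht j hj)); omega
  · push Not at hm
    have ht := h.type I (subset_refl _) 1 (by
      intro j hj
      have := hm j hj
      have hc2 := h.c2 j hj
      by_cases hb : b j ≤ 1
      · left
        refine ⟨hb, ?_⟩
        by_cases hb0 : b j = 0
        · omega
        · have := h.low1 hn hp hj (by omega); omega
      · right
        have hb : a j ≤ 1 := by by_contra hc; have := hc2 (by omega) (by omega); omega
        refine ⟨hb, ?_⟩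
        by_cases hb0 : a j = 0
        · omega
        · have := h.symm.low1 hn hp hj (by omega); omega) (by
        rw [h.card]
        obtain ⟨m, rfl⟩ : ∃ m, n = m + 4 := ⟨n - 4, by omega⟩
        obtain ⟨q, rfl⟩ : ∃ q, p = q + m + 2 := ⟨p - m - 2, by omega⟩
        have : (m + 4 - 1) * (q + m + 2) = (m + 3) * (m + 2) + (m + 3) * q := by
          rw [show m + 4 - 1 = m + 3 by omega]; ring
        nlinarith [Nat.zero_le ((m + 3) * q), Nat.zero_le m])
    have key : ∀ (a b : ι → ℕ), Prof I n p a b f → (∀ j ∈ I, b j ≤ 1) → 2 ≤ ∑ i ∈ I, b i → False := by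
      intro a b h hb sb
      have h1 : ∑ i ∈ I, (n - 2) * b i ≤ ∑ i ∈ I, f i := by
        apply Finset.sum_le_sum
        intro i hi
        have := hb i hi
        by_cases hb0 : b i = 0
        · simp [hb0]
        · have hb1 : b i = 1 := by omega
          have := h.low1 hn hp hi hb1
          rw [hb1]; omega
      rw [← Finset.mul_sum] at h1
      have : (n - 2) * 2 ≤ (n - 2) * ∑ i ∈ I, b i := Nat.mul_le_mul_left _ sb
      omega
    rcases ht with ht | ht
    · exact key a b h ht sb
    · exact key b a h.symm ht sa

/-- If all `b`-parts have size at most two. -/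
lemma spread (h : Prof I n p a b f) (hn : 5 ≤ n) (hp : 6 ≤ p) (hb : ∀ j ∈ I, b j ≤ 2) :
    (n - 3) * ∑ i ∈ I, b i + (∑ i ∈ I, b i) % 2 ≤ ∑ i ∈ I, f i := by
  have h1 : ∑ i ∈ I, ((n - 3) * b i + b i % 2) ≤ ∑ i ∈ I, f i := by
    apply Finset.sum_le_sum
    intro i hi
    have := hb i hi
    have h012 : b i = 0 ∨ b i = 1 ∨ b i = 2 := by omega
    rcases h012 with h0 | h0 | h0
    · simp [h0]
    · have := h.low1 (by omega) (by omega) hi h0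
      rw [h0]; omega
    · have := h.low2 hn hp hi h0
      rw [h0]; omega
  rw [Finset.sum_add_distrib, ← Finset.mul_sum] at h1
  have h2 : (∑ i ∈ I, b i) % 2 ≤ ∑ i ∈ I, b i % 2 := by
    rw [Finset.sum_nat_mod]; exact Nat.mod_le _ _
  omega

/-- The no-bad-part dichotomy. -/
lemma nobad (h : Prof I n p a b f) (hn : 5 ≤ n) (hp : 6 ≤ p)
    (hlt : ∑ i ∈ I, f i + 12 < 4 * n) (hm : ∀ i ∈ I, f i + 11 < 3 * n) :
    (∀ j ∈ I, b j ≤ 2) ∨ (∀ j ∈ I, a j ≤ 2) := by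
  have key : ∀ (a b : ι → ℕ), Prof I n p a b f → ∀ j ∈ I, b j ≤ 2 → 2 * b j ≤ f j := by
    intro a b h j hj hb
    have h012 : b j = 0 ∨ b j = 1 ∨ b j = 2 := by omega
    rcases h012 with h0 | h0 | h0
    · omega
    · have := h.low1 (by omega) (by omega) hj h0; omega
    · have := h.low2 hn hp hj h0; omega
  apply h.type I (subset_refl _) 2
  · intro j hj
    have := hm j hj
    have hc3 := h.c3 j hj
    by_cases hb : b j ≤ 2
    · exact Or.inl ⟨hb, key a b h j hj hb⟩
    · have hb : a j ≤ 2 := by by_contra hc; have := hc3 (by omega) (by omega); omega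
      exact Or.inr ⟨hb, key b a h.symm j hj hb⟩
  · rw [h.card]
    have : (n - 1) * 6 ≤ (n - 1) * p := Nat.mul_le_mul_left _ hp
    omega

/-- One bad part, few faults elsewhere. -/
lemma onebad (h : Prof I n p a b f) (hn : 5 ≤ n) (hp : 6 ≤ p) {i : ι} (hi : i ∈ I)
    (hlt : ∑ j ∈ I.erase i, f j + 3 ≤ n) :
    (∀ j ∈ I.erase i, b j = 0) ∨ (∀ j ∈ I.erase i, a j = 0) := by
  have ht := h.type (I.erase i) (Finset.erase_subset _ _) 0 (by
      intro j hj
      by_contra hc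
      have hjI := Finset.mem_of_mem_erase hj
      have := h.c1 j hjI (by omega) (by omega)
      have := sum_one (f := f) hj
      omega) (by
      rw [Finset.card_erase_of_mem hi, h.card, show n - 1 - 1 = n - 2 by omega]
      have : (n - 2) * 6 ≤ (n - 2) * p := Nat.mul_le_mul_left _ hp
      omega)
  simpa using ht

lemma claim3 (h : Prof I n p a b f) (hn : 5 ≤ n) (hp : 6 ≤ p)
    (sa : 3 ≤ ∑ i ∈ I, a i) (sb : 3 ≤ ∑ i ∈ I, b i) : 3 * n ≤ ∑ i ∈ I, f i + 8 := by
  by_contra hlt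
  push Not at hlt
  by_cases hm : ∃ i ∈ I, 3 * n ≤ f i + 11
  · obtain ⟨i, hi, hfi⟩ := hm
    have h2 := Finset.add_sum_erase I f hi
    rcases h.onebad hn hp hi (by omega) with ht | ht
    · have := h.inside hi ht; omega
    · have := h.symm.inside hi ht; omega
  · push Not at hm
    have key : ∀ (a b : ι → ℕ), Prof I n p a b f → (∀ j ∈ I, b j ≤ 2) → 3 ≤ ∑ i ∈ I, b i → False := by
      intro a b h hb sb
      have := h.spread hn hp hb
      by_cases h3 : ∑ i ∈ I, b i = 3
      · rw [h3] at this; omega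
      · have : (n - 3) * 4 ≤ (n - 3) * ∑ i ∈ I, b i := Nat.mul_le_mul_left _ (by omega)
        omega
    rcases h.nobad hn hp (by omega) hm with ht | ht
    · exact key a b h ht sb
    · exact key b a h.symm ht sa

lemma spread4 (h : Prof I n p a b f) (hn : 5 ≤ n) (hp : 6 ≤ p) (hb : ∀ j ∈ I, b j ≤ 2)
    (sb : 4 ≤ ∑ i ∈ I, b i) : 4 * n ≤ ∑ i ∈ I, f i + 12 := by
  have := h.spread hn hp hb
  have : (n - 3) * 4 ≤ (n - 3) * ∑ i ∈ I, b i := Nat.mul_le_mul_left _ (by omega)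
  omega

lemma inside4 (h : Prof I n p a b f) (hn : 5 ≤ n) (hp : 6 ≤ p) {i : ι} (hi : i ∈ I)
    (hlt : f i + b i + 12 < 4 * n) (hb : 4 ≤ b i) : 4 ≤ a i ∧ 4 * n ≤ f i + 17 := by
  have : 4 ≤ a i := by
    have := h.tot i hi
    have : (n - 1) * 6 ≤ (n - 1) * p := Nat.mul_le_mul_left _ hp
    omega
  exact ⟨this, h.c4 i hi this hb⟩

lemma claim4 (h : Prof I n p a b f) (hn : 5 ≤ n) (hp : 6 ≤ p)
    (sa : 4 ≤ ∑ i ∈ I, a i) (sb : 4 ≤ ∑ i ∈ I, b i) : 4 * n ≤ ∑ i ∈ I, f i + 13 := by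
  by_contra hlt
  push Not at hlt
  by_cases hm : ∃ i ∈ I, 3 * n ≤ f i + 11
  · obtain ⟨i, hi, hfi⟩ := hm
    have h2 := Finset.add_sum_erase I f hi
    rcases h.onebad hn hp hi (by omega) with ht | ht
    · have := h.inside hi ht
      have := h.inside4 hn hp hi (by omega) (by omega); omega
    · have := h.symm.inside hi ht
      have := h.symm.inside4 hn hp hi (by omega) (by omega); omega
  · push Not at hm
    rcases h.nobad hn hp (by omega) hm with ht | ht
    · have := h.spread4 hn hp ht sb; omega
    · have := h.symm.spread4 hn hp ht sa; omega

/-- A set `B` of size four, minimum degree two. -/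
lemma claim5 (h : Prof I n p a b f) (hn : 5 ≤ n) (hp : 6 ≤ p)
    (sb : ∑ i ∈ I, b i = 4) (hb1 : ∀ i ∈ I, b i ≠ 1)
    (c5 : ∀ i ∈ I, (∀ j ∈ I.erase i, b j = 0) → b i = 4 → 4 ≤ a i → 4 * n ≤ f i + 16) :
    4 * n ≤ ∑ i ∈ I, f i + 12 := by
  by_cases hb : ∀ j ∈ I, b j ≤ 2
  · exact h.spread4 hn hp hb (by omega)
  · push Not at hb
    obtain ⟨i, hi, hbi⟩ := hb
    have h3 := Finset.add_sum_erase I b hi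
    have h0 : ∀ j ∈ I.erase i, b j = 0 := by
      intro j hj
      have := sum_one (f := b) hj
      have := hb1 j (Finset.mem_of_mem_erase hj)
      omega
    have h4 := h.inside hi h0
    by_contra hlt
    have := h.inside4 hn hp hi (by omega) (by omega)
    have := c5 i hi h0 (by omega) this.1
    omega

lemma claim6 (h : Prof I n p a b f) (hn : 5 ≤ n) (hp : 6 ≤ p)
    (sa : 4 ≤ ∑ i ∈ I, a i) (sb : 4 ≤ ∑ i ∈ I, b i)
    (ha1 : ∀ i ∈ I, a i ≠ 1) (hb1 : ∀ i ∈ I, b i ≠ 1)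
    (c5b : ∀ i ∈ I, (∀ j ∈ I.erase i, b j = 0) → b i = 4 → 4 ≤ a i → 4 * n ≤ f i + 16)
    (c5a : ∀ i ∈ I, (∀ j ∈ I.erase i, a j = 0) → a i = 4 → 4 ≤ b i → 4 * n ≤ f i + 16) :
    4 * n ≤ ∑ i ∈ I, f i + 12 := by
  by_contra hlt
  push Not at hlt
  by_cases hm : ∃ i ∈ I, 3 * n ≤ f i + 11
  · obtain ⟨i, hi, hfi⟩ := hm
    have h2 := Finset.add_sum_erase I f hi
    have ht := h.type (I.erase i) (Finset.erase_subset _ _) 0 (by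
      intro j hj
      by_contra hc
      have hjI := Finset.mem_of_mem_erase hj
      have := ha1 j hjI
      have := hb1 j hjI
      have := h.c2 j hjI (by omega) (by omega)
      have := sum_one (f := f) hj
      omega) (by
      rw [Finset.card_erase_of_mem hi, h.card, show n - 1 - 1 = n - 2 by omega]
      have : (n - 2) * 6 ≤ (n - 2) * p := Nat.mul_le_mul_left _ hp
      omega)
    simp only [Nat.le_zero] at ht
    rcases ht with ht | ht
    · have := h.inside hi ht
      have := h.inside4 hn hp hi (by omega) (by omega)
      have := c5b i hi ht (by omega) (by omega); omega
    · have := h.symm.inside hi ht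
      have := h.symm.inside4 hn hp hi (by omega) (by omega)
      have := c5a i hi ht (by omega) (by omega); omega
  · push Not at hm
    rcases h.nobad hn hp (by omega) hm with ht | ht
    · have := h.spread4 hn hp ht sb; omega
    · have := h.symm.spread4 hn hp ht sa; omega

end Prof

section Lower

set_option linter.unusedSectionVars false

open Equiv

variable {α : Type*} [Fintype α] [DecidableEq α]

/-- Trees of transpositions, built by adding leaves. -/
inductive TreeOn : Finset α → Finset (Perm α) → Prop
  | single (x : α) : TreeOn {x} ∅
  | leaf (S : Finset α) (E : Finset (Perm α)) (l m : α) : TreeOn S E → l ∉ S → m ∈ S →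
      TreeOn (insert l S) (insert (swap l m) E)

/-- The coset of permutations agreeing with `g` off `S`. -/
def coset (g : Perm α) (S : Finset α) : Finset (Perm α) :=
  Finset.univ.filter (fun h => ∀ x, x ∉ S → h x = g x)

lemma mem_coset {g h : Perm α} {S : Finset α} : h ∈ coset g S ↔ ∀ x, x ∉ S → h x = g x := by
  simp [coset]

lemma card_coset (g : Perm α) (S : Finset α) : (coset g S).card = S.card.factorial := by
  have h1 : (coset g S).card = (coset 1 S).card := by
    refine Finset.card_bij' (fun h _ => g⁻¹ * h) (fun h _ => g * h) ?_ ?_ ?_ ?_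
    · intro h hh
      rw [mem_coset] at hh ⊢
      intro x hx
      simp [hh x hx]
    · intro h hh
      rw [mem_coset] at hh ⊢
      intro x hx
      simp [hh x hx]
    · intro h _; simp
    · intro h _; simp
  rw [h1]
  have h2 := Fintype.card_congr (Perm.subtypeEquivSubtypePerm (fun x => x ∈ S))
  rw [Fintype.card_perm, Fintype.card_coe, Fintype.card_subtype] at h2
  rw [h2]
  rfl

/-- A separation of the coset graph. -/
structure CSep (E : Finset (Perm α)) (g : Perm α) (S : Finset α) (A F B : Finset (Perm α)) :
    Prop where
  cover : ∀ h, h ∈ coset g S ↔ h ∈ A ∨ h ∈ F ∨ h ∈ B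
  dAB : Disjoint A B
  dAF : Disjoint A F
  dBF : Disjoint B F
  sep : ∀ x ∈ A, ∀ e ∈ E, x * e ∉ B

lemma TreeOn.invol {S : Finset α} {E : Finset (Perm α)} (h : TreeOn S E) :
    ∀ e ∈ E, e * e = 1 ∧ Perm.sign e = -1 := by
  induction h with
  | single x => simp
  | leaf S E l m _ hl hm ih =>
    intro e he
    rcases Finset.mem_insert.1 he with rfl | he
    · exact ⟨swap_mul_self _ _, Perm.sign_swap (by rintro rfl; exact hl hm)⟩
    · exact ih e he

lemma TreeOn.fix {S : Finset α} {E : Finset (Perm α)} (h : TreeOn S E) :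
    ∀ e ∈ E, ∀ x, x ∉ S → e x = x := by
  induction h with
  | single x => simp
  | leaf S E l m _ hl hm ih =>
    intro e he x hx
    simp only [Finset.mem_insert, not_or] at hx
    rcases Finset.mem_insert.1 he with rfl | he
    · exact swap_apply_of_ne_of_ne hx.1 (by rintro rfl; exact hx.2 hm)
    · exact ih e he x hx.2

lemma CSep.symm {E : Finset (Perm α)} {g : Perm α} {S : Finset α} {A F B : Finset (Perm α)}
    (h : CSep E g S A F B) (hE : ∀ e ∈ E, e * e = 1 ∧ Perm.sign e = -1) : CSep E g S B F A where
  cover x := by rw [h.cover]; tauto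
  dAB := h.dAB.symm
  dAF := h.dBF
  dBF := h.dAF
  sep x hx e he hA := by
    apply h.sep _ hA e he
    rwa [mul_assoc, (hE e he).1, mul_one]

lemma CSep.card {E : Finset (Perm α)} {g : Perm α} {S : Finset α} {A F B : Finset (Perm α)}
    (h : CSep E g S A F B) : A.card + B.card + F.card = S.card.factorial := by
  rw [← card_coset g S]
  have : coset g S = (A ∪ B) ∪ F := by
    ext x; rw [h.cover]; simp; tauto
  rw [this, Finset.card_union_of_disjoint, Finset.card_union_of_disjoint h.dAB]
  rw [Finset.disjoint_union_left]; exact ⟨h.dAF, h.dBF⟩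

/-- The part of a set with prescribed value at `l`. -/
def part (l : α) (A : Finset (Perm α)) (i : α) : Finset (Perm α) := A.filter (fun h => h l = i)

lemma mem_part {l : α} {A : Finset (Perm α)} {i : α} {h : Perm α} :
    h ∈ part l A i ↔ h ∈ A ∧ h l = i := by simp [part]

lemma val_mem {g h : Perm α} {S : Finset α} (hh : h ∈ coset g S) {x : α} (hx : x ∈ S) :
    h x ∈ S.image g := by
  rw [mem_coset] at hh
  rw [Finset.mem_image]
  refine ⟨g.symm (h x), ?_, by simp⟩
  by_contra hc
  have := hh _ hc
  rw [Equiv.apply_symm_apply] at this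
  rw [h.injective this] at hc
  exact hc hx

/-- Sub-cosets. -/
lemma sub_coset (g : Perm α) (S : Finset α) {l : α} (hl : l ∉ S) {i : α}
    (hi : i ∈ (insert l S).image g) :
    ∃ g' ∈ coset g (insert l S), g' l = i ∧
      ∀ h, h ∈ coset g' S ↔ h ∈ coset g (insert l S) ∧ h l = i := by
  obtain ⟨y, hy, rfl⟩ := Finset.mem_image.1 hi
  have hg' : ∀ x, x ∉ insert l S → (g * swap l y) x = g x := by
    intro x hx
    rw [Perm.mul_apply, swap_apply_of_ne_of_ne]
    · rintro rfl; simp at hx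
    · rintro rfl; exact hx hy
  refine ⟨g * swap l y, mem_coset.2 hg', by simp, ?_⟩
  intro h
  rw [mem_coset, mem_coset]
  constructor
  · intro hh
    refine ⟨fun x hx => ?_, by rw [hh l hl]; simp⟩
    rw [hh x (fun hc => hx (Finset.mem_insert_of_mem hc)), hg' x hx]
  · rintro ⟨h1, h2⟩ x hx
    by_cases hxl : x = l
    · subst hxl; rw [h2]; simp
    · have : x ∉ insert l S := by simp [hxl, hx]
      rw [h1 x this, hg' x this]

lemma CSep.sub {E : Finset (Perm α)} {g : Perm α} {S : Finset α} {A F B : Finset (Perm α)}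
    {l m : α} (hl : l ∉ S)
    (h : CSep (insert (swap l m) E) g (insert l S) A F B) {i : α}
    (hi : i ∈ (insert l S).image g) :
    ∃ g', CSep E g' S (part l A i) (part l F i) (part l B i) := by
  obtain ⟨g', -, -, hg'⟩ := sub_coset g S hl hi
  refine ⟨g', ⟨fun x => ?_, ?_, ?_, ?_, ?_⟩⟩
  · rw [hg', h.cover, mem_part, mem_part, mem_part]; tauto
  · exact Finset.disjoint_filter_filter h.dAB
  · exact Finset.disjoint_filter_filter h.dAF
  · exact Finset.disjoint_filter_filter h.dBF
  · intro x hx e he hB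
    rw [mem_part] at hx hB
    exact h.sep x hx.1 e (Finset.mem_insert_of_mem he) hB.1

lemma sum_part {g : Perm α} {S : Finset α} {l : α} (hl : l ∈ S) {A : Finset (Perm α)}
    (hA : A ⊆ coset g S) : ∑ i ∈ S.image g, (part l A i).card = A.card := by
  rw [Finset.card_eq_sum_card_fiberwise (f := fun h : Perm α => h l) (t := S.image g)]
  · rfl
  · intro x hx; exact val_mem (hA hx) hl

lemma card_two {g : Perm α} {S : Finset α} {l m : α} (hl : l ∉ S) (hm : m ∈ S) {i j : α}
    (hi : i ∈ (insert l S).image g) (hj : j ∈ (insert l S).image g) (hij : i ≠ j) :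
    ((coset g (insert l S)).filter (fun h => h l = i ∧ h m = j)).card = (S.card - 1).factorial := by
  obtain ⟨g', hg1, hg2, hg'⟩ := sub_coset g S hl hi
  have hmS : insert m (S.erase m) = S := Finset.insert_erase hm
  have hj' : j ∈ (insert m (S.erase m)).image g' := by
    rw [hmS]
    rw [mem_coset] at hg1
    rw [Finset.mem_image]
    refine ⟨g'.symm j, ?_, by simp⟩
    by_contra hc
    by_cases hcl : g'.symm j = l
    · rw [Equiv.symm_apply_eq, hg2] at hcl; exact hij hcl.symm
    · have h3 : g'.symm j ∉ insert l S := by simp [hcl, hc]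
      have := hg1 _ h3
      simp only [Equiv.apply_symm_apply] at this
      obtain ⟨y, hy, rfl⟩ := Finset.mem_image.1 hj
      have := g.injective this
      rw [← this] at h3; exact h3 hy
  obtain ⟨g'', -, -, hg''⟩ := sub_coset g' (S.erase m) (Finset.notMem_erase m S) hj'
  rw [← Finset.card_erase_of_mem hm, ← card_coset g'']
  congr 1
  ext x
  rw [hg'', hmS, hg', Finset.mem_filter]
  tauto

lemma CSep.hx {E : Finset (Perm α)} {g : Perm α} {S : Finset α} {A F B : Finset (Perm α)}
    {l m : α} (hl : l ∉ S) (hm : m ∈ S)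
    (h : CSep (insert (swap l m) E) g (insert l S) A F B) (P Q : Finset α)
    (hP : P ⊆ (insert l S).image g) (hQ : Q ⊆ (insert l S).image g) (hd : Disjoint P Q) :
    P.card * Q.card * (S.card - 1).factorial ≤
      ∑ i ∈ P, ((part l F i).card + (part l B i).card) +
      ∑ i ∈ Q, ((part l F i).card + (part l A i).card) := by
  set X := (coset g (insert l S)).filter (fun h => h l ∈ P ∧ h m ∈ Q) with hX
  have hXc : X.card = P.card * Q.card * (S.card - 1).factorial := by
    rw [Finset.card_eq_sum_card_fiberwise (f := fun h : Perm α => (h l, h m)) (t := P ×ˢ Q)]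
    · rw [← Finset.card_product, ← smul_eq_mul]
      apply Finset.sum_const_nat
      rintro ⟨i, j⟩ hij
      rw [Finset.mem_product] at hij
      rw [← card_two hl hm (hP hij.1) (hQ hij.2) (fun he => Finset.disjoint_left.1 hd hij.1 (by have h9 := hij.2; rw [← he] at h9; exact h9))]
      congr 1
      ext x
      simp only [hX, Finset.mem_filter, Prod.mk.injEq]
      constructor
      · tauto
      · rintro ⟨h1, h2, h3⟩
        refine ⟨⟨h1, ?_, ?_⟩, h2, h3⟩
        · rw [h2]; exact hij.1
        · rw [h3]; exact hij.2
    · intro x hx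
      rw [hX, Finset.mem_coe, Finset.mem_filter] at hx
      simp [hx.2.1, hx.2.2]
  set Y := P.biUnion (fun i => part l F i ∪ part l B i) with hY
  set Z := Q.biUnion (fun i => part l F i ∪ part l A i) with hZ
  have hsub : X ⊆ Y ∪ Z.image (fun x => x * swap l m) := by
    intro x hx
    rw [hX, Finset.mem_filter] at hx
    obtain ⟨hxc, hxl, hxm⟩ := hx
    rw [Finset.mem_union]
    rcases (h.cover x).1 hxc with hA | hF | hB
    · right
      rw [Finset.mem_image]
      refine ⟨x * swap l m, ?_, by simp [mul_assoc]⟩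
      have hval : (x * swap l m) l = x m := by simp
      have h1 : x * swap l m ∈ coset g (insert l S) := by
        rw [mem_coset] at hxc ⊢
        intro y hy
        have hy' := hy
        simp only [Finset.mem_insert, not_or] at hy'
        rw [Perm.mul_apply, swap_apply_of_ne_of_ne hy'.1 (by rintro rfl; exact hy'.2 hm)]
        exact hxc y hy
      have h2 := h.sep x hA _ (Finset.mem_insert_self _ _)
      rw [hZ, Finset.mem_biUnion]
      refine ⟨x m, hxm, ?_⟩
      rw [Finset.mem_union, mem_part, mem_part]
      have := (h.cover _).1 h1
      tauto
    · left
      rw [hY, Finset.mem_biUnion]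
      exact ⟨x l, hxl, Finset.mem_union_left _ (mem_part.2 ⟨hF, rfl⟩)⟩
    · left
      rw [hY, Finset.mem_biUnion]
      exact ⟨x l, hxl, Finset.mem_union_right _ (mem_part.2 ⟨hB, rfl⟩)⟩
  rw [← hXc]
  refine (Finset.card_le_card hsub).trans ((Finset.card_union_le _ _).trans (Nat.add_le_add ?_ ?_))
  · exact Finset.card_biUnion_le.trans (Finset.sum_le_sum fun i _ => Finset.card_union_le _ _)
  · exact Finset.card_image_le.trans
      (Finset.card_biUnion_le.trans (Finset.sum_le_sum fun i _ => Finset.card_union_le _ _))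

lemma CSep.hb {E : Finset (Perm α)} {g : Perm α} {S : Finset α} {A F B : Finset (Perm α)}
    {l m : α} (hl : l ∉ S) (hm : m ∈ S)
    (h : CSep (insert (swap l m) E) g (insert l S) A F B) (i : α) :
    (part l A i).card ≤ ∑ j ∈ ((insert l S).image g).erase i,
      ((part l F j).card + (part l A j).card) := by
  set Z := (((insert l S).image g).erase i).biUnion (fun j => part l F j ∪ part l A j) with hZ
  have hcard : Z.card ≤ _ := Finset.card_biUnion_le.trans
    (Finset.sum_le_sum fun i _ => Finset.card_union_le _ _)
  refine le_trans ?_ hcard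
  refine Finset.card_le_card_of_injOn (fun x => x * swap l m) ?_
    (fun x _ y _ hxy => mul_right_cancel hxy)
  intro x hx
  rw [Finset.mem_coe, mem_part] at hx
  obtain ⟨hA, hxl⟩ := hx
  have hxc : x ∈ coset g (insert l S) := (h.cover x).2 (Or.inl hA)
  have h1 : x * swap l m ∈ coset g (insert l S) := by
    rw [mem_coset] at hxc ⊢
    intro y hy
    have hy' := hy
    simp only [Finset.mem_insert, not_or] at hy'
    rw [Perm.mul_apply, swap_apply_of_ne_of_ne hy'.1 (by rintro rfl; exact hy'.2 hm)]
    exact hxc y hy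
  have h2 := h.sep x hA _ (Finset.mem_insert_self _ _)
  have hval : (x * swap l m) l = x m := by simp
  simp only [Finset.mem_coe]
  rw [hZ, Finset.mem_biUnion]
  refine ⟨x m, ?_, ?_⟩
  · rw [Finset.mem_erase]
    refine ⟨?_, val_mem hxc (Finset.mem_insert_of_mem hm)⟩
    rw [← hxl]
    intro hc
    have := x.injective hc
    subst this; exact hl hm
  · rw [Finset.mem_union, mem_part, mem_part]
    have := (h.cover _).1 h1
    tauto

/-- Minimum degree at least two. -/
def R2 (E : Finset (Perm α)) (B : Finset (Perm α)) : Prop :=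
  ∀ x ∈ B, 2 ≤ (E.filter (fun e => x * e ∈ B)).card

/-- The inductive package. -/
structure Pack (S : Finset α) (E : Finset (Perm α)) : Prop where
  c1 : ∀ g A F B, CSep E g S A F B → 1 ≤ A.card → 1 ≤ B.card → S.card ≤ F.card + 1
  c2 : ∀ g A F B, CSep E g S A F B → 2 ≤ A.card → 2 ≤ B.card → 2 * S.card ≤ F.card + 4
  c3 : ∀ g A F B, CSep E g S A F B → 3 ≤ A.card → 3 ≤ B.card → 3 * S.card ≤ F.card + 8
  c4 : ∀ g A F B, CSep E g S A F B → 4 ≤ A.card → 4 ≤ B.card → 4 * S.card ≤ F.card + 13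
  c5 : ∀ g A F B, CSep E g S A F B → 4 ≤ A.card → B.card = 4 → R2 E B → 4 * S.card ≤ F.card + 12

lemma prof_of {E : Finset (Perm α)} {g : Perm α} {S : Finset α} {A F B : Finset (Perm α)}
    {l m : α} (hl : l ∉ S) (hm : m ∈ S) (hE : TreeOn S E) (pk : Pack S E)
    (h : CSep (insert (swap l m) E) g (insert l S) A F B) :
    Prof ((insert l S).image g) (insert l S).card (S.card - 1).factorial
      (fun i => (part l A i).card) (fun i => (part l B i).card) (fun i => (part l F i).card) where
  card := Finset.card_image_of_injective _ g.injective
  tot i hi := by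
    obtain ⟨g', hg'⟩ := h.sub hl hi
    rw [hg'.card, Finset.card_insert_of_notMem hl, Nat.add_sub_cancel, Nat.mul_factorial_pred]
    exact Finset.card_ne_zero_of_mem hm
  c1 i hi x y := by
    obtain ⟨g', hg'⟩ := h.sub hl hi
    have := pk.c1 _ _ _ _ hg' x y
    rw [Finset.card_insert_of_notMem hl]; omega
  c2 i hi x y := by
    obtain ⟨g', hg'⟩ := h.sub hl hi
    have := pk.c2 _ _ _ _ hg' x y
    rw [Finset.card_insert_of_notMem hl]; omega
  c3 i hi x y := by
    obtain ⟨g', hg'⟩ := h.sub hl hi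
    have := pk.c3 _ _ _ _ hg' x y
    rw [Finset.card_insert_of_notMem hl]; omega
  c4 i hi x y := by
    obtain ⟨g', hg'⟩ := h.sub hl hi
    have := pk.c4 _ _ _ _ hg' x y
    rw [Finset.card_insert_of_notMem hl]; omega
  hx P Q hP hQ hd := h.hx hl hm P Q hP hQ hd
  hb i _ := (h.symm (TreeOn.leaf S E l m hE hl hm).invol).hb hl hm i
  ha i _ := h.hb hl hm i

lemma R2.part_ne_one {E : Finset (Perm α)} {S : Finset α} {B : Finset (Perm α)}
    {l m : α} (hl : l ∉ S) (hE : TreeOn S E)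
    (h : R2 (insert (swap l m) E) B) (i : α) : (part l B i).card ≠ 1 := by
  intro h1
  obtain ⟨x, hx⟩ := Finset.card_eq_one.1 h1
  have hxm : x ∈ part l B i := by rw [hx]; simp
  rw [mem_part] at hxm
  have h2 := h x hxm.1
  have h3 : ∃ e ∈ (insert (swap l m) E).filter (fun e => x * e ∈ B), e ≠ swap l m :=
    Finset.exists_mem_ne (by omega) _
  obtain ⟨e, he, hne⟩ := h3
  rw [Finset.mem_filter, Finset.mem_insert] at he
  have heE : e ∈ E := he.1.resolve_left hne
  have : x * e ∈ part l B i := by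
    rw [mem_part]; refine ⟨he.2, ?_⟩
    rw [Perm.mul_apply, hE.fix e heE l hl]; exact hxm.2
  rw [hx, Finset.mem_singleton] at this
  have h4 : e = 1 := by simpa using this
  have := (hE.invol e heE).2
  rw [h4] at this
  simp at this

lemma R2.sub {E : Finset (Perm α)} {S : Finset α} {A F B : Finset (Perm α)} {g : Perm α}
    {l m : α} (hl : l ∉ S) (hm : m ∈ S)
    (hs : CSep (insert (swap l m) E) g (insert l S) A F B)
    (h : R2 (insert (swap l m) E) B) (i : α)
    (h0 : ∀ j ∈ ((insert l S).image g).erase i, (part l B j).card = 0) : R2 E (part l B i) := by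
  intro x hx
  rw [mem_part] at hx
  refine (h x hx.1).trans (Finset.card_le_card ?_)
  intro e he
  rw [Finset.mem_filter] at he ⊢
  have hc : x * e ∈ coset g (insert l S) := (hs.cover _).2 (Or.inr (Or.inr he.2))
  have hv := val_mem hc (Finset.mem_insert_self l S)
  have hi : (x * e) l = i := by
    by_contra hne
    have := h0 _ (Finset.mem_erase.2 ⟨hne, hv⟩)
    rw [Finset.card_eq_zero] at this
    have h5 : x * e ∈ part l B ((x * e) l) := mem_part.2 ⟨he.2, rfl⟩
    rw [this] at h5; simp at h5
  refine ⟨?_, mem_part.2 ⟨he.2, hi⟩⟩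
  rcases Finset.mem_insert.1 he.1 with rfl | h6
  · exfalso
    rw [← hx.2] at hi
    simp at hi
    subst hi; exact hl hm
  · exact h6

lemma CSep.subs {E : Finset (Perm α)} {g : Perm α} {S : Finset α} {A F B : Finset (Perm α)}
    (h : CSep E g S A F B) : A ⊆ coset g S ∧ F ⊆ coset g S ∧ B ⊆ coset g S :=
  ⟨fun x hx => (h.cover x).2 (Or.inl hx), fun x hx => (h.cover x).2 (Or.inr (Or.inl hx)),
    fun x hx => (h.cover x).2 (Or.inr (Or.inr hx))⟩

lemma c5_sub {E : Finset (Perm α)} {g : Perm α} {S : Finset α} {A F B : Finset (Perm α)}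
    {l m : α} (hl : l ∉ S) (hm : m ∈ S) (pk : Pack S E)
    (h : CSep (insert (swap l m) E) g (insert l S) A F B) (hR : R2 (insert (swap l m) E) B) :
    ∀ i ∈ (insert l S).image g, (∀ j ∈ ((insert l S).image g).erase i, (part l B j).card = 0) →
      (part l B i).card = 4 → 4 ≤ (part l A i).card →
      4 * (insert l S).card ≤ (part l F i).card + 16 := by
  intro i hi h0 hb ha
  obtain ⟨g', hg'⟩ := h.sub hl hi
  have := pk.c5 _ _ _ _ hg' ha hb (hR.sub hl hm h i h0)
  rw [Finset.card_insert_of_notMem hl]; omega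

lemma pack {S : Finset α} {E : Finset (Perm α)} (h : TreeOn S E) : Pack S E := by
  induction h with
  | single x =>
    constructor <;> intros <;> simp only [Finset.card_singleton] <;> omega
  | leaf S E l m hE hl hm pk =>
    have hcS : (insert l S).card = S.card + 1 := Finset.card_insert_of_notMem hl
    have hS1 : 1 ≤ S.card := Finset.card_pos.2 ⟨m, hm⟩
    have hp1 : 1 ≤ (S.card - 1).factorial := Nat.factorial_pos _
    have hp' : S.card - 1 ≤ (S.card - 1).factorial := Nat.self_le_factorial _
    have hp2 : 3 ≤ S.card → 2 ≤ (S.card - 1).factorial := fun h => by omega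
    have hp6 : 4 ≤ S.card → 6 ≤ (S.card - 1).factorial := fun h => by
      have : Nat.factorial 3 ≤ (S.card - 1).factorial := Nat.factorial_le (by omega)
      simpa [Nat.factorial] using this
    have hp0 : S.card = 1 → (S.card - 1).factorial = 1 := fun h => by simp [h]
    have sums : ∀ g A F B, CSep (insert (swap l m) E) g (insert l S) A F B →
        ∑ i ∈ (insert l S).image g, (part l A i).card = A.card ∧
        ∑ i ∈ (insert l S).image g, (part l F i).card = F.card ∧
        ∑ i ∈ (insert l S).image g, (part l B i).card = B.card := by
      intro g A F B hs
      have hl' := Finset.mem_insert_self l S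
      exact ⟨sum_part hl' hs.subs.1, sum_part hl' hs.subs.2.1, sum_part hl' hs.subs.2.2⟩
    have C1 : ∀ g A F B, CSep (insert (swap l m) E) g (insert l S) A F B →
        1 ≤ A.card → 1 ≤ B.card → (insert l S).card ≤ F.card + 1 := by
      intro g A F B hs ha hb
      obtain ⟨h1, h2, h3⟩ := sums g A F B hs
      have := (prof_of hl hm hE pk hs).claim1 (by omega) hp1 (fun h => hp0 (by omega))
        (fun h => hp2 (by omega)) (by rw [h1]; exact ha) (by rw [h3]; exact hb)
      rw [h2] at this; exact this
    have C2 : ∀ g A F B, CSep (insert (swap l m) E) g (insert l S) A F B →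
        2 ≤ A.card → 2 ≤ B.card → 2 * (insert l S).card ≤ F.card + 4 := by
      intro g A F B hs ha hb
      by_cases hn : 4 ≤ (insert l S).card
      · obtain ⟨h1, h2, h3⟩ := sums g A F B hs
        have := (prof_of hl hm hE pk hs).claim2 hn (hp2 (by omega)) (by omega)
          (by rw [h1]; exact ha) (by rw [h3]; exact hb)
        rw [h2] at this; exact this
      · have := C1 g A F B hs (by omega) (by omega); omega
    have C3 : ∀ g A F B, CSep (insert (swap l m) E) g (insert l S) A F B →
        3 ≤ A.card → 3 ≤ B.card → 3 * (insert l S).card ≤ F.card + 8 := by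
      intro g A F B hs ha hb
      by_cases hn : 5 ≤ (insert l S).card
      · obtain ⟨h1, h2, h3⟩ := sums g A F B hs
        have := (prof_of hl hm hE pk hs).claim3 hn (hp6 (by omega))
          (by rw [h1]; exact ha) (by rw [h3]; exact hb)
        rw [h2] at this; exact this
      · have := C1 g A F B hs (by omega) (by omega)
        have := C2 g A F B hs (by omega) (by omega); omega
    refine ⟨C1, C2, C3, ?_, ?_⟩
    · intro g A F B hs ha hb
      by_cases hn : 5 ≤ (insert l S).card
      · obtain ⟨h1, h2, h3⟩ := sums g A F B hs
        have := (prof_of hl hm hE pk hs).claim4 hn (hp6 (by omega))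
          (by rw [h1]; exact ha) (by rw [h3]; exact hb)
        rw [h2] at this; exact this
      · have := C1 g A F B hs (by omega) (by omega)
        have := C2 g A F B hs (by omega) (by omega); omega
    · intro g A F B hs ha hb hR
      by_cases hn : 5 ≤ (insert l S).card
      · obtain ⟨h1, h2, h3⟩ := sums g A F B hs
        have := (prof_of hl hm hE pk hs).claim5 hn (hp6 (by omega))
          (by rw [h3]; exact hb) (fun i _ => hR.part_ne_one hl hE i)
          (c5_sub hl hm pk hs hR)
        rw [h2] at this; exact this
      · have := C1 g A F B hs (by omega) (by omega)
        have := C2 g A F B hs (by omega) (by omega); omega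

lemma R2.four {S : Finset α} {E : Finset (Perm α)} (hE : TreeOn S E) {B : Finset (Perm α)}
    (h : R2 E B) (hB : B.Nonempty) : 4 ≤ B.card := by
  obtain ⟨x, hx⟩ := hB
  obtain ⟨e1, h1, e2, h2, h12⟩ := Finset.one_lt_card.1 (h x hx)
  rw [Finset.mem_filter] at h1 h2
  obtain ⟨e3, h3, h31⟩ := Finset.exists_mem_ne (h (x * e1) h1.2) e1
  rw [Finset.mem_filter] at h3
  have s1 := hE.invol e1 h1.1
  have s2 := hE.invol e2 h2.1
  have s3 := hE.invol e3 h3.1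
  have n1 : e1 ≠ 1 := fun hc => by have := s1.2; rw [hc] at this; simp at this
  have n2 : e2 ≠ 1 := fun hc => by have := s2.2; rw [hc] at this; simp at this
  have n3 : e3 ≠ 1 := fun hc => by have := s3.2; rw [hc] at this; simp at this
  have n13 : e1 * e3 ≠ 1 := fun hc => h31 (mul_left_cancel (hc.trans s1.1.symm))
  have n132 : e2 ≠ e1 * e3 := fun hc => by
    have := congrArg Perm.sign hc
    rw [Perm.sign_mul, s1.2, s2.2, s3.2] at this
    simp at this
  have hsub : ({x, x * e1, x * e2, x * e1 * e3} : Finset (Perm α)) ⊆ B := by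
    intro y hy
    simp only [Finset.mem_insert, Finset.mem_singleton] at hy
    rcases hy with rfl | rfl | rfl | rfl
    · exact hx
    · exact h1.2
    · exact h2.2
    · exact h3.2
  refine le_trans (le_of_eq ?_) (Finset.card_le_card hsub)
  symm
  have m1 : x ≠ x * e1 := fun hc => n1 (by simpa using hc)
  have m2 : x ≠ x * e2 := fun hc => n2 (by simpa using hc)
  have m3 : x ≠ x * e1 * e3 := fun hc => n13 (by simpa [mul_assoc] using hc)
  have m4 : x * e1 ≠ x * e2 := fun hc => h12 (by simpa using hc)
  have m5 : x * e1 ≠ x * e1 * e3 := fun hc => n3 (by simpa using hc)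
  have m6 : x * e2 ≠ x * e1 * e3 := fun hc => n132 (by simpa [mul_assoc] using hc)
  rw [Finset.card_insert_of_notMem, Finset.card_insert_of_notMem, Finset.card_pair m6]
  · simp [m4, m5]
  · simp only [Finset.mem_insert, Finset.mem_singleton]; tauto

lemma lower {S : Finset α} {E : Finset (Perm α)} (hE : TreeOn S E) (hn : 5 ≤ S.card)
    {g : Perm α} {A F B : Finset (Perm α)} (hs : CSep E g S A F B) (hA : R2 E A) (hB : R2 E B)
    (nA : A.Nonempty) (nB : B.Nonempty) : 4 * S.card ≤ F.card + 12 := by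
  have fA := hA.four hE nA
  have fB := hB.four hE nB
  cases hE with
  | single x => simp at hn
  | leaf S E l m hE hl hm =>
    have hcS : (insert l S).card = S.card + 1 := Finset.card_insert_of_notMem hl
    have hp6 : 6 ≤ (S.card - 1).factorial := by
      have : Nat.factorial 3 ≤ (S.card - 1).factorial := Nat.factorial_le (by omega)
      simpa [Nat.factorial] using this
    have hl' := Finset.mem_insert_self l S
    have h1 := sum_part hl' hs.subs.1
    have h2 := sum_part hl' hs.subs.2.1
    have h3 := sum_part hl' hs.subs.2.2
    have pk := pack hE
    have := (prof_of hl hm hE pk hs).claim6 hn hp6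
      (by rw [h1]; exact fA) (by rw [h3]; exact fB)
      (fun i _ => hA.part_ne_one hl hE i) (fun i _ => hB.part_ne_one hl hE i)
      (c5_sub hl hm pk hs hB)
      (c5_sub hl hm pk (hs.symm (TreeOn.leaf S E l m hE hl hm).invol) hA)
    rw [h2] at this; exact this

end Lower

section Glue

open Equiv

variable {n : ℕ} {T : Set (Perm (Fin n))}

lemma trans_adj {i j : Fin n} : (transGraph T).Adj i j ↔ i ≠ j ∧ swap i j ∈ T := by
  rw [transGraph, SimpleGraph.fromRel_adj, swap_comm j i, or_self]

lemma T_invol (hT : ∀ t ∈ T, Perm.IsSwap t) : ∀ t ∈ T, t * t = 1 ∧ Perm.sign t = -1 := by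
  intro t ht
  obtain ⟨x, y, hxy, rfl⟩ := hT t ht
  exact ⟨swap_mul_self _ _, Perm.sign_swap hxy⟩

lemma bridge (hT : ∀ t ∈ T, Perm.IsSwap t) (hac : (transGraph T).IsAcyclic) {t : Perm (Fin n)}
    (ht : t ∈ T) : t ∉ Subgroup.closure (T \ {t}) := by
  intro hc
  obtain ⟨p, q, hpq, rfl⟩ := hT t ht
  have hadj : (transGraph T).Adj p q := trans_adj.2 ⟨hpq, ht⟩
  have hb := SimpleGraph.isAcyclic_iff_forall_adj_isBridge.1 hac hadj
  rw [SimpleGraph.isBridge_iff] at hb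
  have key : ∀ σ ∈ Subgroup.closure (T \ {swap p q}), ∀ x,
      ((transGraph T).deleteEdges {s(p, q)}).Reachable x (σ x) := by
    intro σ hσ
    induction hσ using Subgroup.closure_induction with
    | mem t ht' =>
      intro x
      obtain ⟨y, z, hyz, rfl⟩ := hT t ht'.1
      have hne : swap y z ≠ swap p q := fun h => ht'.2 h
      have hA : ((transGraph T).deleteEdges {s(p, q)}).Adj y z := by
        rw [SimpleGraph.deleteEdges_adj]
        refine ⟨trans_adj.2 ⟨hyz, ht'.1⟩, ?_⟩
        intro h
        rw [Set.mem_singleton_iff, Sym2.eq_iff] at h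
        rcases h with ⟨rfl, rfl⟩ | ⟨rfl, rfl⟩
        · exact hne rfl
        · exact hne (swap_comm _ _)
      by_cases hxy : x = y
      · subst hxy; rw [swap_apply_left]; exact hA.reachable
      · by_cases hxz : x = z
        · subst hxz; rw [swap_apply_right]; exact hA.symm.reachable
        · rw [swap_apply_of_ne_of_ne hxy hxz]
    | one => intro x; exact SimpleGraph.Reachable.refl _
    | mul σ τ _ _ h1 h2 => intro x; exact (h2 x).trans (h1 (τ x))
    | inv σ _ h1 =>
      intro x
      have := h1 (σ⁻¹ x)
      rw [← Perm.mul_apply, mul_inv_cancel] at this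
      exact this.symm
  have := key _ hc p
  rw [swap_apply_left] at this
  exact hb this

lemma bridge_list (hT : ∀ t ∈ T, Perm.IsSwap t) (hac : (transGraph T).IsAcyclic)
    {t : Perm (Fin n)} (ht : t ∈ T) (L : List (Perm (Fin n))) (hL : ∀ x ∈ L, x ∈ T)
    (h : t = L.prod) : t ∈ L := by
  by_contra hc
  apply bridge hT hac ht
  rw [h]
  apply Subgroup.list_prod_mem
  intro x hx
  apply Subgroup.subset_closure
  refine ⟨hL x hx, ?_⟩
  rw [← h]
  rintro rfl
  exact hc hx

lemma TreeOn.swaps {α : Type*} [Fintype α] [DecidableEq α] {S : Finset α} {E : Finset (Perm α)}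
    (h : TreeOn S E) : ∀ p ∈ S, ∀ q ∈ S, swap p q ∈ Subgroup.closure (E : Set (Perm α)) := by
  induction h with
  | single x => intro p hp q hq; simp at hp hq; subst hp; subst hq; rw [swap_self]; exact Subgroup.one_mem _
  | leaf S E l m hE hl hm ih =>
    have hmono : Subgroup.closure (E : Set (Perm α)) ≤
        Subgroup.closure ((insert (swap l m) E : Finset (Perm α)) : Set (Perm α)) :=
      Subgroup.closure_mono (by simp)
    have hlm : swap l m ∈ Subgroup.closure ((insert (swap l m) E : Finset (Perm α)) : Set (Perm α)) :=
      Subgroup.subset_closure (by simp)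
    have hlq : ∀ q ∈ S, swap l q ∈
        Subgroup.closure ((insert (swap l m) E : Finset (Perm α)) : Set (Perm α)) := by
      intro q hq
      by_cases hqm : q = m
      · subst hqm; exact hlm
      · have h1 := hmono (ih m hm q hq)
        have h2 : swap l q = swap l m * swap m q * swap l m := by
          have hlq : l ≠ q := by rintro rfl; exact hl hq
          rw [swap_comm l m, swap_comm m q, swap_mul_swap_mul_swap hqm hlq.symm]
        rw [h2]
        exact Subgroup.mul_mem _ (Subgroup.mul_mem _ hlm h1) hlm
    intro p hp q hq
    rcases Finset.mem_insert.1 hp with hp' | hp' <;> rcases Finset.mem_insert.1 hq with hq' | hq'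
    · rw [hp', hq', swap_self]; exact Subgroup.one_mem _
    · rw [hp']; exact hlq q hq'
    · rw [hq', swap_comm p l]; exact hlq p hp'
    · exact hmono (ih p hp' q hq')

lemma TreeOn.card_edges {α : Type*} [Fintype α] [DecidableEq α] {S : Finset α}
    {E : Finset (Perm α)} (h : TreeOn S E) : E.card + 1 = S.card := by
  induction h with
  | single x => simp
  | leaf S E l m hE hl hm ih =>
    have : swap l m ∉ E := by
      intro hc
      have := hE.fix _ hc l hl
      rw [swap_apply_left] at this
      subst this; exact hl hm
    rw [Finset.card_insert_of_notMem this, Finset.card_insert_of_notMem hl, ih]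

lemma exists_treeOn (hn : 1 ≤ n) (hT : ∀ t ∈ T, Perm.IsSwap t) (ht : (transGraph T).IsTree) :
    ∃ E : Finset (Perm (Fin n)), TreeOn Finset.univ E ∧ ∀ t, t ∈ E ↔ t ∈ T := by
  have grow : ∀ k, k + 1 ≤ n → ∃ (S : Finset (Fin n)) (E : Finset (Perm (Fin n))),
      TreeOn S E ∧ (∀ t ∈ E, t ∈ T) ∧ S.card = k + 1 := by
    intro k
    induction k with
    | zero => intro _; exact ⟨{⟨0, hn⟩}, ∅, TreeOn.single _, by simp, by simp⟩
    | succ k ih =>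
      intro hk
      obtain ⟨S, E, hE, hET, hS⟩ := ih (by omega)
      obtain ⟨x, hx⟩ : S.Nonempty := Finset.card_pos.1 (by omega)
      obtain ⟨y, hy⟩ : ∃ y, y ∉ S := by
        by_contra hc
        push Not at hc
        have : S = Finset.univ := Finset.eq_univ_iff_forall.2 hc
        rw [this, Finset.card_univ, Fintype.card_fin] at hS
        omega
      obtain ⟨w⟩ := ht.connected.preconnected x y
      obtain ⟨d, -, hd1, hd2⟩ := w.exists_boundary_dart (S : Set (Fin n)) hx hy
      have hadj := trans_adj.1 d.adj
      refine ⟨insert d.snd S, _, TreeOn.leaf S E d.snd d.fst hE hd2 hd1, ?_, ?_⟩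
      · intro t ht
        rcases Finset.mem_insert.1 ht with rfl | ht
        · rw [swap_comm]; exact hadj.2
        · exact hET t ht
      · rw [Finset.card_insert_of_notMem hd2, hS]
  obtain ⟨S, E, hE, hET, hS⟩ := grow (n - 1) (by omega)
  have hSu : S = Finset.univ := by
    apply Finset.eq_univ_of_card
    rw [hS, Fintype.card_fin]; omega
  subst hSu
  refine ⟨E, hE, fun t => ⟨hET t, fun htT => ?_⟩⟩
  by_contra hc
  apply bridge hT ht.isAcyclic htT
  obtain ⟨p, q, -, hpq⟩ := hT t htT
  have := hE.swaps p (Finset.mem_univ _) q (Finset.mem_univ _)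
  rw [← hpq] at this
  refine Subgroup.closure_mono ?_ this
  intro e he
  exact ⟨hET e he, by rintro rfl; exact hc he⟩

lemma cayley_adj (hT : ∀ t ∈ T, Perm.IsSwap t) {g h : Perm (Fin n)} :
    (cayley T).Adj g h ↔ ∃ t ∈ T, h = g * t := by
  rw [cayley, SimpleGraph.fromRel_adj]
  constructor
  · rintro ⟨-, ⟨t, ht, h⟩ | ⟨t, ht, h⟩⟩
    · exact ⟨t, ht, h⟩
    · exact ⟨t, ht, by rw [h, mul_assoc, (T_invol hT t ht).1, mul_one]⟩
  · rintro ⟨t, ht, rfl⟩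
    refine ⟨?_, Or.inl ⟨t, ht, rfl⟩⟩
    intro hc
    have h1 : t = 1 := by simpa using hc
    have := (T_invol hT t ht).2
    rw [h1] at this; simp at this

lemma cut_lower (hn : 5 ≤ n) (hT : ∀ t ∈ T, Perm.IsSwap t) (ht : (transGraph T).IsTree)
    (F : Set (Perm (Fin n))) (hF : IsRkCut (cayley T) 2 F) : 4 * n - 12 ≤ F.ncard := by
  classical
  obtain ⟨E, hE, hET⟩ := exists_treeOn (by omega) hT ht
  obtain ⟨hcon, hdeg⟩ := hF
  by_cases hemp : F = Set.univ
  · rw [hemp, Set.ncard_univ, Nat.card_eq_fintype_card, Fintype.card_perm, Fintype.card_fin]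
    have h1 : n * (n - 1).factorial = n.factorial := Nat.mul_factorial_pred (by omega)
    have h2 : n - 1 ≤ (n - 1).factorial := Nat.self_le_factorial _
    have h3 : n * 4 ≤ n * (n - 1).factorial := Nat.mul_le_mul_left _ (by omega)
    omega
  · have hne : (Fᶜ : Set (Perm (Fin n))).Nonempty := Set.nonempty_compl.2 hemp
    have hpre : ¬ ((cayley T).induce (Fᶜ : Set (Perm (Fin n)))).Preconnected := by
      intro hp
      exact hcon (by have := hne.to_subtype; exact ⟨hp⟩)
    unfold SimpleGraph.Preconnected at hpre
    push Not at hpre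
    obtain ⟨u, v, huv⟩ := hpre
    set A : Finset (Perm (Fin n)) := Finset.univ.filter (fun x => ∃ h : x ∈ (Fᶜ : Set (Perm (Fin n))),
      ((cayley T).induce (Fᶜ : Set (Perm (Fin n)))).Reachable u ⟨x, h⟩) with hA
    set B : Finset (Perm (Fin n)) := Finset.univ.filter (fun x => x ∉ F ∧ x ∉ A) with hB
    have mA : ∀ x, x ∈ A ↔ ∃ h : x ∈ (Fᶜ : Set (Perm (Fin n))),
      ((cayley T).induce (Fᶜ : Set (Perm (Fin n)))).Reachable u ⟨x, h⟩ := fun x => by simp [hA]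
    have mB : ∀ x, x ∈ B ↔ x ∉ F ∧ x ∉ A := fun x => by simp [hB]
    have AF : ∀ x ∈ A, x ∉ F := fun x hx => ((mA x).1 hx).1
    have step : ∀ x ∈ A, ∀ e ∈ E, x * e ∉ F → x * e ∈ A := by
      intro x hx e he hxe
      obtain ⟨h1, h2⟩ := (mA x).1 hx
      refine (mA _).2 ⟨hxe, h2.trans ?_⟩
      apply SimpleGraph.Adj.reachable
      rw [SimpleGraph.induce_adj]
      exact (cayley_adj hT).2 ⟨e, (hET e).1 he, rfl⟩
    have hs : CSep E 1 Finset.univ A F.toFinset B := by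
      refine ⟨fun x => ?_, ?_, ?_, ?_, ?_⟩
      · rw [mem_coset, mB, Set.mem_toFinset]
        simp only [Finset.mem_univ, not_true_eq_false, false_imp_iff, implies_true, true_iff]
        tauto
      · rw [Finset.disjoint_left]; intro x hx hx'; exact ((mB x).1 hx').2 hx
      · rw [Finset.disjoint_left]; intro x hx hx'; exact AF x hx (Set.mem_toFinset.1 hx')
      · rw [Finset.disjoint_left]; intro x hx hx'; exact ((mB x).1 hx).1 (Set.mem_toFinset.1 hx')
      · intro x hx e he hx'
        exact ((mB _).1 hx').2 (step x hx e he ((mB _).1 hx').1)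
    have hs' := hs.symm hE.invol
    have gen : ∀ C : Finset (Perm (Fin n)), (∀ x ∈ C, x ∉ F) →
        (∀ x ∈ C, ∀ e ∈ E, x * e ∉ F → x * e ∈ C) → R2 E C := by
      intro C hC hst x hx
      have h1 := hdeg x (hC x hx)
      refine h1.trans ?_
      have h2 : {u : Perm (Fin n) | u ∉ F ∧ (cayley T).Adj x u} ⊆
          (((E.filter (fun e => x * e ∈ C)).image (fun e => x * e) : Finset (Perm (Fin n))) :
            Set (Perm (Fin n))) := by
        rintro y ⟨hy, hadj⟩
        obtain ⟨t, htT, rfl⟩ := (cayley_adj hT).1 hadj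
        have htE := (hET t).2 htT
        rw [Finset.mem_coe, Finset.mem_image]
        exact ⟨t, Finset.mem_filter.2 ⟨htE, hst x hx t htE hy⟩, rfl⟩
      refine (Set.ncard_le_ncard h2 (Finset.finite_toSet _)).trans ?_
      rw [Set.ncard_coe_finset]
      exact Finset.card_image_le
    have RA : R2 E A := gen A AF step
    have RB : R2 E B := by
      refine gen B (fun x hx => ((mB x).1 hx).1) ?_
      intro x hx e he hxe
      refine (mB _).2 ⟨hxe, ?_⟩
      exact hs'.sep x hx e he
    have nA : A.Nonempty := ⟨u, (mA _).2 ⟨u.2, SimpleGraph.Reachable.refl _⟩⟩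
    have nB : B.Nonempty := ⟨v, (mB _).2 ⟨v.2, fun hv => huv ((mA _).1 hv).2⟩⟩
    have := lower hE (by simpa using hn) hs RA RB nA nB
    rw [Finset.card_univ, Fintype.card_fin] at this
    rw [Set.ncard_eq_toFinset_card']
    omega

lemma disjoint_pair (hn : 5 ≤ n) (hT : ∀ t ∈ T, Perm.IsSwap t) (ht : (transGraph T).IsTree)
    (hns : ¬ ∃ c : Fin n, ∀ i j : Fin n, (transGraph T).Adj i j → i = c ∨ j = c) :
    ∃ a ∈ T, ∃ b ∈ T, a ≠ b ∧ a * b = b * a := by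
  have comm : ∀ p q r s : Fin n, p ≠ q → r ≠ s → p ≠ r → p ≠ s → q ≠ r → q ≠ s →
      swap p q ∈ T → swap r s ∈ T → ∃ a ∈ T, ∃ b ∈ T, a ≠ b ∧ a * b = b * a := by
    intro p q r s hpq hrs hpr hps hqr hqs h1 h2
    refine ⟨_, h1, _, h2, ?_, ?_⟩
    · intro h
      have := congrArg (fun σ => σ p) h
      simp only [swap_apply_left] at this
      rw [swap_apply_of_ne_of_ne hpr hps] at this
      exact hpq this.symm
    · have hd : Perm.Disjoint (swap p q) (swap r s) := by
        intro x
        by_cases hx : x = r ∨ x = s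
        · left
          rcases hx with rfl | rfl
          · exact swap_apply_of_ne_of_ne hpr.symm hqr.symm
          · exact swap_apply_of_ne_of_ne hps.symm hqs.symm
        · right
          push Not at hx
          exact swap_apply_of_ne_of_ne hx.1 hx.2
      exact hd.commute
  push Not at hns
  obtain ⟨p, q, hpq, -⟩ := hns ⟨0, by omega⟩
  have hpq' := trans_adj.1 hpq
  -- an edge avoiding a vertex, meeting another
  have av : ∀ p q : Fin n, p ≠ q → swap p q ∈ T →
      (∃ a ∈ T, ∃ b ∈ T, a ≠ b ∧ a * b = b * a) ∨ ∃ r, r ≠ p ∧ r ≠ q ∧ swap q r ∈ T := by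
    intro p q hpq hT'
    obtain ⟨i, j, hij, hi, hj⟩ := hns p
    have hij' := trans_adj.1 hij
    by_cases hiq : i = q
    · subst hiq; exact Or.inr ⟨j, hj, hij'.1.symm, hij'.2⟩
    · by_cases hjq : j = q
      · subst hjq; exact Or.inr ⟨i, hi, hiq, by rw [swap_comm]; exact hij'.2⟩
      · exact Or.inl (comm p q i j hpq hij'.1 hi.symm hj.symm (Ne.symm hiq) (Ne.symm hjq) hT' hij'.2)
  rcases av p q hpq'.1 hpq'.2 with h | ⟨r, hrp, hrq, hr⟩
  · exact h
  rcases av q p hpq'.1.symm (by rw [swap_comm]; exact hpq'.2) with h | ⟨r', hrq', hrp', hr'⟩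
  · exact h
  by_cases hrr : r = r'
  · subst hrr
    exfalso
    have h1 : swap p q = [swap q r, swap p r, swap q r].prod := by
      simp only [List.prod_cons, List.prod_nil, mul_one]
      rw [← mul_assoc, swap_comm q r, swap_mul_swap_mul_swap hrp.symm hpq'.1]; exact swap_comm _ _
    have h2 := bridge_list hT ht.isAcyclic hpq'.2 _ (by
      intro x hx
      simp only [List.mem_cons, List.not_mem_nil, or_false] at hx
      rcases hx with rfl | rfl | rfl
      · exact hr
      · exact hr'
      · exact hr) h1
    simp only [List.mem_cons, List.not_mem_nil, or_false] at h2
    rcases h2 with h | h | h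
    · have := congrArg (fun σ => σ p) h
      simp only [swap_apply_left] at this
      rw [swap_apply_of_ne_of_ne hpq'.1 hrp.symm] at this
      exact hpq'.1 this.symm
    · have := congrArg (fun σ => σ p) h
      simp only [swap_apply_left] at this
      exact hrq this.symm
    · have := congrArg (fun σ => σ p) h
      simp only [swap_apply_left] at this
      rw [swap_apply_of_ne_of_ne hpq'.1 hrp.symm] at this
      exact hpq'.1 this.symm
  · exact comm q r p r' hrq.symm hrp'.symm hpq'.1.symm hrq'.symm hrp hrr hr hr'

end Glue

section Upper

open Equiv

variable {n : ℕ} {T : Set (Perm (Fin n))}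

lemma pairP (hT : ∀ t ∈ T, Perm.IsSwap t) (hac : (transGraph T).IsAcyclic)
    {t u t' u' : Perm (Fin n)} (ht : t ∈ T) (hu : u ∈ T) (ht' : t' ∈ T) (hu' : u' ∈ T)
    (huu : u ≠ u') (htu : t ≠ u) (h : t * u = t' * u') : t = u' := by
  have h1 : t = [t', u', u].prod := by
    simp only [List.prod_cons, List.prod_nil, mul_one]
    rw [← mul_assoc, ← h, mul_assoc, (T_invol hT u hu).1, mul_one]
  have h2 := bridge_list hT hac ht _ (by
    intro x hx
    simp only [List.mem_cons, List.not_mem_nil, or_false] at hx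
    rcases hx with rfl | rfl | rfl <;> assumption) h1
  simp only [List.mem_cons, List.not_mem_nil, or_false] at h2
  rcases h2 with h2 | h2 | h2
  · subst h2; exact absurd (mul_left_cancel h) huu
  · exact h2
  · exact absurd h2 htu

lemma tripleQ (hT : ∀ t ∈ T, Perm.IsSwap t) (hac : (transGraph T).IsAcyclic)
    {a b : Perm (Fin n)} (ha : a ∈ T) (hb : b ∈ T) (hab : a ≠ b)
    {v c c₃ t₁ u₁ t₂ u₂ t₃ u₃ : Perm (Fin n)}
    (ht₁ : t₁ ∈ T) (hu₁ : u₁ ∈ T) (ht₂ : t₂ ∈ T) (hu₂ : u₂ ∈ T) (ht₃ : t₃ ∈ T) (hu₃ : u₃ ∈ T)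
    (h1a : t₁ ≠ a) (h1b : t₁ ≠ b) (h2a : t₂ ≠ a) (h2b : t₂ ≠ b) (h3a : t₃ ≠ a) (h3b : t₃ ≠ b)
    (h12 : u₁ ≠ u₂) (h13 : u₁ ≠ u₃) (h23 : u₂ ≠ u₃)
    (e1 : v * u₁ = c * t₁) (e2 : v * u₂ = c * t₂) (e3 : v * u₃ = c₃ * t₃)
    (hvc : v ≠ c) (hc₃ : c₃ = c ∨ c₃ = c * (a * b)) : False := by
  have f : ∀ {u c t}, u ∈ T → v * u = c * t → v = c * (t * u) := by
    intro u c t hu h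
    rw [← mul_assoc, ← h, mul_assoc, (T_invol hT u hu).1, mul_one]
  have g1 := f hu₁ e1
  have g2 := f hu₂ e2
  have g3 := f hu₃ e3
  have n1 : t₁ ≠ u₁ := by
    rintro rfl; apply hvc; rw [g1, (T_invol hT _ hu₁).1, mul_one]
  have n2 : t₂ ≠ u₂ := by
    rintro rfl; apply hvc; rw [g2, (T_invol hT _ hu₂).1, mul_one]
  have e12 : t₁ * u₁ = t₂ * u₂ := mul_left_cancel (g1.symm.trans g2)
  have k1 : t₁ = u₂ := pairP hT hac ht₁ hu₁ ht₂ hu₂ h12 n1 e12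
  have k2 : t₂ = u₁ := pairP hT hac ht₂ hu₂ ht₁ hu₁ h12.symm n2 e12.symm
  rcases hc₃ with rfl | rfl
  · have k3 : t₁ = u₃ := pairP hT hac ht₁ hu₁ ht₃ hu₃ h13 n1 (mul_left_cancel (g1.symm.trans g3))
    exact h23 (k1.symm.trans k3)
  · have e : t₁ * u₁ = a * b * (t₃ * u₃) := by
      apply mul_left_cancel (a := c)
      rw [← g1, g3]; simp only [mul_assoc]
    have ia : a * a = 1 := (T_invol hT _ ha).1
    have ib : b * b = 1 := (T_invol hT _ hb).1
    have i3 : t₃ * t₃ = 1 := (T_invol hT _ ht₃).1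
    have j3 : u₃ * u₃ = 1 := (T_invol hT _ hu₃).1
    have p1 : t₁ * u₁ * u₃ * t₃ = a * b := by
      rw [e]; simp only [mul_assoc]
      rw [← mul_assoc u₃ u₃, j3, one_mul, i3, mul_one]
    have q1 : a = [t₁, u₁, u₃, t₃, b].prod := by
      simp only [List.prod_cons, List.prod_nil, mul_one, ← mul_assoc]
      rw [p1, mul_assoc, ib, mul_one]
    have q2 : b = [a, t₁, u₁, u₃, t₃].prod := by
      have : [a, t₁, u₁, u₃, t₃].prod = a * (t₁ * u₁ * u₃ * t₃) := by
        simp only [List.prod_cons, List.prod_nil, mul_one, mul_assoc]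
      rw [this, p1, ← mul_assoc, ia, one_mul]
    have r1 := bridge_list hT hac ha _ (by
      intro x hx
      simp only [List.mem_cons, List.not_mem_nil, or_false] at hx
      rcases hx with rfl | rfl | rfl | rfl | rfl <;> assumption) q1
    have r2 := bridge_list hT hac hb _ (by
      intro x hx
      simp only [List.mem_cons, List.not_mem_nil, or_false] at hx
      rcases hx with rfl | rfl | rfl | rfl | rfl <;> assumption) q2
    simp only [List.mem_cons, List.not_mem_nil, or_false] at r1 r2
    have s1 : a = u₃ := by
      rcases r1 with r | r | r | r | r
      · exact absurd r.symm h1a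
      · exact absurd (k2.trans r.symm) h2a
      · exact r
      · exact absurd r.symm h3a
      · exact absurd r hab
    have s2 : b = u₃ := by
      rcases r2 with r | r | r | r | r
      · exact absurd r.symm hab
      · exact absurd r.symm h1b
      · exact absurd (k2.trans r.symm) h2b
      · exact r
      · exact absurd r.symm h3b
    exact hab (s1.trans s2.symm)

lemma exists_cut (hn : 5 ≤ n) (hT : ∀ t ∈ T, Perm.IsSwap t) (ht : (transGraph T).IsTree)
    (hns : ¬ ∃ c : Fin n, ∀ i j : Fin n, (transGraph T).Adj i j → i = c ∨ j = c) :
    ∃ F : Set (Perm (Fin n)), IsRkCut (cayley T) 2 F ∧ F.ncard ≤ 4 * n - 12 := by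
  classical
  obtain ⟨a, ha, b, hb, hab, hcomm⟩ := disjoint_pair hn hT ht hns
  obtain ⟨E, hE, hET⟩ := exists_treeOn (by omega) hT ht
  have hac := ht.isAcyclic
  have hEc : E.card = n - 1 := by
    have := hE.card_edges
    rw [Finset.card_univ, Fintype.card_fin] at this; omega
  have ia : a * a = 1 := (T_invol hT _ ha).1
  have ib : b * b = 1 := (T_invol hT _ hb).1
  set C : Finset (Perm (Fin n)) := {1, a, b, a * b} with hC
  have mC : ∀ x, x ∈ C ↔ x = 1 ∨ x = a ∨ x = b ∨ x = a * b := by intro x; simp [hC]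
  set E' := (E.erase a).erase b with hE'
  have mE' : ∀ t, t ∈ E' ↔ t ≠ b ∧ t ≠ a ∧ t ∈ T := by
    intro t; simp [hE', hET]
  set F : Finset (Perm (Fin n)) := (C ×ˢ E').image (fun p => p.1 * p.2) with hF
  have mF : ∀ x, x ∈ F ↔ ∃ c ∈ C, ∃ t ∈ E', x = c * t := by
    intro x
    simp only [hF, Finset.mem_image, Finset.mem_product, Prod.exists]
    constructor
    · rintro ⟨c, t, ⟨h1, h2⟩, h⟩; exact ⟨c, h1, t, h2, h.symm⟩
    · rintro ⟨c, h1, t, h2, h⟩; exact ⟨c, t, ⟨h1, h2⟩, h.symm⟩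
  have cC : C.card ≤ 4 := Finset.card_le_four
  have cE' : E'.card = n - 3 := by
    rw [hE', Finset.card_erase_of_mem, Finset.card_erase_of_mem ((hET a).2 ha), hEc]
    · omega
    · exact Finset.mem_erase.2 ⟨hab.symm, (hET b).2 hb⟩
  have cF : F.card ≤ 4 * n - 12 := by
    refine Finset.card_image_le.trans ?_
    rw [Finset.card_product, cE']
    have := Nat.mul_le_mul_right (n - 3) cC
    omega
  have Ca : ∀ x ∈ C, x * a ∈ C := by
    intro x hx
    rw [mC] at hx ⊢
    rcases hx with rfl | rfl | rfl | rfl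
    · simp
    · simp [ia]
    · simp [hcomm]
    · right; right; left; rw [hcomm, mul_assoc, ia, mul_one]
  have Cb : ∀ x ∈ C, x * b ∈ C := by
    intro x hx
    rw [mC] at hx ⊢
    rcases hx with rfl | rfl | rfl | rfl
    · simp
    · simp
    · simp [ib]
    · right; left; rw [mul_assoc, ib, mul_one]
  have Ccl : ∀ x ∈ C, x ∈ Subgroup.closure ({a, b} : Set (Perm (Fin n))) := by
    intro x hx
    have h1 : a ∈ Subgroup.closure ({a, b} : Set (Perm (Fin n))) :=
      Subgroup.subset_closure (by simp)
    have h2 : b ∈ Subgroup.closure ({a, b} : Set (Perm (Fin n))) :=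
      Subgroup.subset_closure (by simp)
    rw [mC] at hx
    rcases hx with rfl | rfl | rfl | rfl
    · exact Subgroup.one_mem _
    · exact h1
    · exact h2
    · exact Subgroup.mul_mem _ h1 h2
  have CF : ∀ x ∈ C, x ∉ F := by
    intro x hx hxF
    obtain ⟨c, hc, t, htE, h⟩ := (mF x).1 hxF
    obtain ⟨htb, hta, htT⟩ := (mE' t).1 htE
    apply bridge hT hac htT
    have h3 : t = c⁻¹ * x := by rw [h]; simp
    have h4 := Subgroup.mul_mem _ (Subgroup.inv_mem _ (Ccl c hc)) (Ccl x hx)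
    rw [← h3] at h4
    refine Subgroup.closure_mono ?_ h4
    rintro y (rfl | rfl)
    · exact ⟨ha, fun h => hta h.symm⟩
    · exact ⟨hb, fun h => htb h.symm⟩
  have sC : ∀ c ∈ C, ∀ c' ∈ C, Perm.sign c = Perm.sign c' → c' = c ∨ c' = c * (a * b) := by
    have sa := (T_invol hT _ ha).2
    have sb := (T_invol hT _ hb).2
    have z1 : a * (a * b) = b := by rw [← mul_assoc, ia, one_mul]
    have z2 : b * (a * b) = a := by rw [hcomm, ← mul_assoc, ib, one_mul]
    have z3 : a * b * (a * b) = 1 := by rw [mul_assoc, z2, ia]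
    have hne : (-1 : ℤˣ) ≠ 1 := by decide
    intro c hc c' hc' hs
    rw [mC] at hc hc'
    rcases hc with rfl | rfl | rfl | rfl <;> rcases hc' with rfl | rfl | rfl | rfl <;>
      simp [Perm.sign_mul, sa, sb, z1, z2, z3] at hs ⊢
  have FT : ∀ v u, u ∈ T → v * u ∈ F → ∃ c ∈ C, ∃ t ∈ T, t ≠ a ∧ t ≠ b ∧ v * u = c * t ∧
      Perm.sign c = Perm.sign v := by
    intro v u hu h
    obtain ⟨c, hc, t, htE, h⟩ := (mF _).1 h
    obtain ⟨htb, hta, htT⟩ := (mE' t).1 htE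
    refine ⟨c, hc, t, htT, hta, htb, h, ?_⟩
    have := congrArg Perm.sign h
    rw [Perm.sign_mul, Perm.sign_mul, (T_invol hT _ hu).2, (T_invol hT _ htT).2] at this
    exact (mul_right_cancel this).symm
  refine ⟨(F : Set (Perm (Fin n))), ⟨?_, ?_⟩, ?_⟩
  · intro hcon
    have hex : ∃ v, v ∉ C ∪ F := by
      by_contra hc
      push Not at hc
      have h1 : C ∪ F = Finset.univ := Finset.eq_univ_iff_forall.2 hc
      have h2 := Finset.card_union_le C F
      rw [h1, Finset.card_univ, Fintype.card_perm, Fintype.card_fin] at h2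
      have h3 : n * (n - 1).factorial = n.factorial := Nat.mul_factorial_pred (by omega)
      have h4 : n - 1 ≤ (n - 1).factorial := Nat.self_le_factorial _
      have h5 : n * 4 ≤ n * (n - 1).factorial := Nat.mul_le_mul_left _ (by omega)
      omega
    obtain ⟨v, hv⟩ := hex
    rw [Finset.mem_union, not_or] at hv
    have h1C : (1 : Perm (Fin n)) ∈ C := (mC 1).2 (Or.inl rfl)
    obtain ⟨w⟩ := hcon.preconnected ⟨1, fun h => CF 1 h1C (Finset.mem_coe.1 h)⟩
      ⟨v, fun h => hv.2 (Finset.mem_coe.1 h)⟩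
    obtain ⟨d, -, hd1, hd2⟩ := w.exists_boundary_dart {x | (x : Perm (Fin n)) ∈ C} h1C hv.1
    have hadj := d.adj
    rw [SimpleGraph.induce_adj] at hadj
    obtain ⟨t, htT, hd⟩ := (cayley_adj hT).1 hadj
    simp only [Set.mem_ofPred_eq] at hd1 hd2
    by_cases hta : t = a
    · subst hta; apply hd2; rw [hd]; exact Ca _ hd1
    by_cases htb : t = b
    · subst htb; apply hd2; rw [hd]; exact Cb _ hd1
    apply d.snd.2
    rw [Finset.mem_coe, mF]
    exact ⟨_, hd1, t, (mE' t).2 ⟨htb, hta, htT⟩, hd⟩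
  · intro v hv
    rw [Finset.mem_coe] at hv
    by_cases hvC : v ∈ C
    · have hsub : (({v * a, v * b} : Finset (Perm (Fin n))) : Set (Perm (Fin n))) ⊆
          {u | u ∉ (F : Set (Perm (Fin n))) ∧ (cayley T).Adj v u} := by
        intro x hx
        rw [Finset.mem_coe, Finset.mem_insert, Finset.mem_singleton] at hx
        rcases hx with rfl | rfl
        · exact ⟨fun h => CF _ (Ca _ hvC) (Finset.mem_coe.1 h), (cayley_adj hT).2 ⟨a, ha, rfl⟩⟩
        · exact ⟨fun h => CF _ (Cb _ hvC) (Finset.mem_coe.1 h), (cayley_adj hT).2 ⟨b, hb, rfl⟩⟩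
      refine le_trans ?_ (Set.ncard_le_ncard hsub (Set.toFinite _))
      rw [Set.ncard_coe_finset, Finset.card_pair]
      exact fun h => hab (mul_left_cancel h)
    · have hbad : (E.filter (fun u => v * u ∈ F)).card ≤ 2 := by
        by_contra hc
        push Not at hc
        obtain ⟨u₁, m1, u₂, m2, u₃, m3, h12, h13, h23⟩ := Finset.two_lt_card.1 hc
        rw [Finset.mem_filter, hET] at m1 m2 m3
        obtain ⟨c₁, hc₁, t₁, ht₁, h1a, h1b, e1, s1⟩ := FT v u₁ m1.1 m1.2
        obtain ⟨c₂, hc₂, t₂, ht₂, h2a, h2b, e2, s2⟩ := FT v u₂ m2.1 m2.2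
        obtain ⟨c₃, hc₃, t₃, ht₃, h3a, h3b, e3, s3⟩ := FT v u₃ m3.1 m3.2
        have nv : ∀ c ∈ C, v ≠ c := by rintro c hc rfl; exact hvC hc
        by_cases k12 : c₂ = c₁
        · subst k12
          exact tripleQ hT hac ha hb hab ht₁ m1.1 ht₂ m2.1 ht₃ m3.1 h1a h1b h2a h2b h3a h3b
            h12 h13 h23 e1 e2 e3 (nv _ hc₁) (sC _ hc₁ _ hc₃ (s1.trans s3.symm))
        · by_cases k13 : c₃ = c₁
          · subst k13
            exact tripleQ hT hac ha hb hab ht₁ m1.1 ht₃ m3.1 ht₂ m2.1 h1a h1b h3a h3b h2a h2b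
              h13 h12 h23.symm e1 e3 e2 (nv _ hc₁) (sC _ hc₁ _ hc₂ (s1.trans s2.symm))
          · have w2 := (sC _ hc₁ _ hc₂ (s1.trans s2.symm)).resolve_left k12
            have w3 := (sC _ hc₁ _ hc₃ (s1.trans s3.symm)).resolve_left k13
            have w : c₃ = c₂ := w3.trans w2.symm
            subst w
            exact tripleQ hT hac ha hb hab ht₂ m2.1 ht₃ m3.1 ht₁ m1.1 h2a h2b h3a h3b h1a h1b
              h23 h12.symm h13.symm e2 e3 e1 (nv _ hc₂) (sC _ hc₂ _ hc₁ (s2.trans s1.symm))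
      have hsum := Finset.card_filter_add_card_filter_not (s := E) (fun u => v * u ∈ F)
      have hsub : (((E.filter (fun u => ¬ v * u ∈ F)).image (fun u => v * u) :
          Finset (Perm (Fin n))) : Set (Perm (Fin n))) ⊆
          {u | u ∉ (F : Set (Perm (Fin n))) ∧ (cayley T).Adj v u} := by
        intro x hx
        rw [Finset.mem_coe, Finset.mem_image] at hx
        obtain ⟨u, hu, rfl⟩ := hx
        rw [Finset.mem_filter, hET] at hu
        exact ⟨fun h => hu.2 (Finset.mem_coe.1 h), (cayley_adj hT).2 ⟨u, hu.1, rfl⟩⟩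
      refine le_trans ?_ (Set.ncard_le_ncard hsub (Set.toFinite _))
      rw [Set.ncard_coe_finset, Finset.card_image_of_injective _ (mul_right_injective v)]
      omega
  · rw [Set.ncard_coe_finset]; exact cF

end Upper

/-- For `n ≥ 5` and a set `𝒯` of transpositions whose generating graph `G(𝒯)` is a
tree on `n` vertices which is not a star (its edges do not all share a common vertex),
the `R_2`-vertex-connectivity of `Cay(Sym(n), 𝒯)` equals `4n - 12`. -/
theorem stmt17 (n : ℕ) (hn : 5 ≤ n)
    (T : Set (Equiv.Perm (Fin n))) (hT : ∀ t ∈ T, Equiv.Perm.IsSwap t)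
    (htree : (transGraph T).IsTree)
    (hnotstar : ¬ ∃ c : Fin n, ∀ i j : Fin n, (transGraph T).Adj i j → i = c ∨ j = c) :
    rkConn (cayley T) 2 = 4 * n - 12 := by
  obtain ⟨F, hF, hc⟩ := exists_cut hn hT htree hnotstar
  have hne : {m : ℕ | ∃ F : Set (Equiv.Perm (Fin n)), IsRkCut (cayley T) 2 F ∧
      F.ncard = m}.Nonempty := ⟨_, F, hF, rfl⟩
  apply le_antisymm
  · have h : rkConn (cayley T) 2 ≤ F.ncard := Nat.sInf_le ⟨F, hF, rfl⟩
    exact h.trans hc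
  · obtain ⟨F', hF', hc'⟩ := Nat.sInf_mem hne
    rw [rkConn, ← hc']
    exact cut_lower hn hT htree F' hF'
end
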